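/- arXiv:2303.06916 — 6 statements merged into one kernel-verified Lean document; each statement's English description precedes it below -/
import Mathlib

section
/- Transience criterion (Lemma 3.5 of the paper). Let V : [0,∞) → (0,∞) be a continuous function with V(x) → 0 as x → ∞, and let κ = (κ_t)_{t≥0} be a [0,∞)-valued continuous adapted process satisfying limsup_{t→∞} κ_t = ∞ almost surely. Suppose there exists r₀ > 0 such that for every stopping time T with T < ∞ almost surely and every r ∈ (r₀,∞), the process (V(κ_{(t+T)∧S_{r,T}}))_{t≥0} is an (F_{t+T})-supermartingale, i.e. E[V(κ_{(t+T)∧S_{r,T}}) | F_{s+T}] ≤ V(κ_{(s+T)∧S_{r,T}}) almost surely for all 0 ≤ s ≤ t < ∞. Then P(lim_{t→∞} κ_t = ∞) = 1. -/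
open MeasureTheory Filter Set
open scoped NNReal ENNReal

variable {Ω : Type*}

/-- First time after the stopping time `T` at which `κ` drops to level `ℓ` or below
(`∞` if this never happens, or if `T = ∞`). -/
noncomputable def hitBelow (κ : ℝ≥0 → Ω → ℝ≥0) (ℓ : ℝ≥0) (T : Ω → ℝ≥0∞) (ω : Ω) : ℝ≥0∞ :=
  T ω + sInf ((fun u : ℝ≥0 => (u : ℝ≥0∞)) ''
    {u : ℝ≥0 | T ω ≠ ⊤ ∧ κ ((T ω).toNNReal + u) ω ≤ ℓ})

/-- First time after the stopping time `T` at which `κ` rises to level `r` or above. -/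
noncomputable def hitAbove (κ : ℝ≥0 → Ω → ℝ≥0) (r : ℝ≥0) (T : Ω → ℝ≥0∞) (ω : Ω) : ℝ≥0∞ :=
  T ω + sInf ((fun u : ℝ≥0 => (u : ℝ≥0∞)) ''
    {u : ℝ≥0 | T ω ≠ ⊤ ∧ r ≤ κ ((T ω).toNNReal + u) ω})

/-- `S_{r,T} := λ_{r₀,T} ∧ ρ_{r,T}`, the first exit time from `[r₀, r]` after `T`. -/
noncomputable def exitTime (κ : ℝ≥0 → Ω → ℝ≥0) (r₀ r : ℝ≥0) (T : Ω → ℝ≥0∞) (ω : Ω) : ℝ≥0∞ :=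
  min (hitBelow κ r₀ T ω) (hitAbove κ r T ω)

/-- A `[0,∞]`-valued stopping time for the filtration `ℱ`. -/
def IsStoppingTimeE {m0 : MeasurableSpace Ω} (ℱ : Filtration ℝ≥0 m0) (T : Ω → ℝ≥0∞) : Prop :=
  ∀ t : ℝ≥0, MeasurableSet[ℱ t] {ω | T ω ≤ (t : ℝ≥0∞)}

/-- The σ-algebra `F_T` at the stopping time `T`. -/
noncomputable def stoppedSigma {m0 : MeasurableSpace Ω} (ℱ : Filtration ℝ≥0 m0)
    (T : Ω → ℝ≥0∞) : MeasurableSpace Ω :=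
  MeasurableSpace.generateFrom
    {A | ∀ t : ℝ≥0, MeasurableSet[ℱ t] (A ∩ {ω | T ω ≤ (t : ℝ≥0∞)})}

/-- The stopped process `t ↦ V(κ_{(t+T) ∧ S_{r,T}})`. -/
noncomputable def stoppedV (κ : ℝ≥0 → Ω → ℝ≥0) (V : ℝ≥0 → ℝ) (r₀ r : ℝ≥0)
    (T : Ω → ℝ≥0∞) (t : ℝ≥0) (ω : Ω) : ℝ :=
  V (κ ((min ((t : ℝ≥0∞) + T ω) (exitTime κ r₀ r T ω)).toNNReal) ω)

/-- Maximal inequality: if `X` is nonnegative and decreases in mean on the events that none of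
`B 0, …, B k` has occurred, while `X k ≥ c` on `E ∩ B k`, then the probability that `E` and one
of the `B k` occur is at most `𝔼[X 0] / c`. -/
theorem mul_measureReal_inter_exists_le {m0 : MeasurableSpace Ω} {μ : Measure Ω}
    [IsFiniteMeasure μ] {X : ℕ → Ω → ℝ} (hint : ∀ k, Integrable (X k) μ)
    (hnn : ∀ k ω, 0 ≤ X k ω) {B : ℕ → Set Ω} (hB : ∀ k, MeasurableSet (B k))
    (hstep : ∀ k, ∫ ω in {ω | ∀ j ≤ k, ω ∉ B j}, X (k + 1) ω ∂μ
      ≤ ∫ ω in {ω | ∀ j ≤ k, ω ∉ B j}, X k ω ∂μ)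
    {E : Set Ω} {c : ℝ} (hc : 0 ≤ c) {K : ℕ}
    (hE : ∀ k < K, ∀ ω ∈ E ∩ B k, c ≤ X k ω) :
    c * μ.real (E ∩ {ω | ∃ j < K, ω ∈ B j}) ≤ ∫ ω, X 0 ω ∂μ := by
  suffices h : c * μ.real (E ∩ {ω | ∃ j < K, ω ∈ B j})
      + ∫ ω in {ω | ∀ j < K, ω ∉ B j}, X K ω ∂μ ≤ ∫ ω, X 0 ω ∂μ by
    have := setIntegral_nonneg_of_ae (μ := μ) (s := {ω | ∀ j < K, ω ∉ B j})
      (Eventually.of_forall (hnn K))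
    linarith
  induction K with
  | zero => simp
  | succ k ih =>
    refine le_trans ?_ (ih fun j hj => hE j (hj.trans k.lt_succ_self))
    have hD : MeasurableSet {ω | ∀ j < k, ω ∉ B j} := by
      have : {ω | ∀ j < k, ω ∉ B j} = ⋂ j, ⋂ (_ : j < k), (B j)ᶜ := by ext; simp
      rw [this]
      exact MeasurableSet.iInter fun j => MeasurableSet.iInter fun _ => (hB j).compl
    have hsplit : ∫ ω in {ω | ∀ j < k, ω ∉ B j}, X k ω ∂μ
        = ∫ ω in {ω | ∀ j < k, ω ∉ B j} ∩ B k, X k ω ∂μ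
          + ∫ ω in {ω | ∀ j ≤ k, ω ∉ B j}, X k ω ∂μ := by
      rw [← integral_inter_add_sdiff (hB k) (hint k).integrableOn]
      congr 3
      ext ω
      simp only [Set.mem_sdiff, mem_ofPred_eq]
      constructor
      · rintro ⟨h1, h2⟩ j hj
        rcases hj.lt_or_eq with h | rfl
        exacts [h1 j h, h2]
      · exact fun h => ⟨fun j hj => h j hj.le, h k le_rfl⟩
    have hsub : E ∩ {ω | ∃ j < k + 1, ω ∈ B j} ⊆ (E ∩ {ω | ∃ j < k, ω ∈ B j})
        ∪ {ω | c ≤ X k ω} ∩ ({ω | ∀ j < k, ω ∉ B j} ∩ B k) := by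
      rintro ω ⟨hω, j, hj, hjB⟩
      by_cases hex : ∃ j < k, ω ∈ B j
      · exact Or.inl ⟨hω, hex⟩
      · push Not at hex
        obtain rfl : j = k := by
          by_contra hne
          exact hex j (by omega) hjB
        exact Or.inr ⟨hE j hj ω ⟨hω, hjB⟩, hex, hjB⟩
    have hmarkov := mul_meas_ge_le_integral_of_nonneg
      (μ := μ.restrict ({ω | ∀ j < k, ω ∉ B j} ∩ B k)) (Eventually.of_forall (hnn k))
      (hint k).integrableOn c
    rw [measureReal_restrict_apply' (hD.inter (hB k))] at hmarkov
    have hle : μ.real (E ∩ {ω | ∃ j < k + 1, ω ∈ B j}) ≤ μ.real (E ∩ {ω | ∃ j < k, ω ∈ B j})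
        + μ.real ({ω | c ≤ X k ω} ∩ ({ω | ∀ j < k, ω ∉ B j} ∩ B k)) :=
      (measureReal_mono hsub).trans (measureReal_union_le _ _)
    have hle' := mul_le_mul_of_nonneg_left hle hc
    have hs := hstep k
    simp only [Nat.lt_succ_iff] at *
    rw [hsplit]
    linarith

theorem le_hitAbove {κ : ℝ≥0 → Ω → ℝ≥0} {r : ℝ≥0} {T : Ω → ℝ≥0} {ω : Ω} {t : ℝ≥0}
    (h : ∀ s ≤ T ω + t, κ s ω < r) :
    (t : ℝ≥0∞) + T ω ≤ hitAbove κ r (fun ω => (T ω : ℝ≥0∞)) ω := by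
  rw [hitAbove, add_comm]
  gcongr
  refine le_sInf ?_
  rintro _ ⟨u, ⟨-, hu⟩, rfl⟩
  rw [ENNReal.toNNReal_coe] at hu
  simp only [ENNReal.coe_le_coe]
  by_contra! hlt
  exact (h (T ω + u) (by gcongr)).not_ge hu

/-- A path that starts above `r₀` and comes down to `r₀` is equal to `r₀` when it first does. -/
theorem apply_toNNReal_hitBelow {κ : ℝ≥0 → Ω → ℝ≥0} {r₀ : ℝ≥0} {T : Ω → ℝ≥0} {ω : Ω}
    (hcont : Continuous fun t => κ t ω) (hT : r₀ < κ (T ω) ω)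
    (hfin : hitBelow κ r₀ (fun ω => (T ω : ℝ≥0∞)) ω ≠ ⊤) :
    κ (hitBelow κ r₀ (fun ω => (T ω : ℝ≥0∞)) ω).toNNReal ω = r₀ := by
  set U : Set ℝ≥0 := {u : ℝ≥0 | κ (T ω + u) ω ≤ r₀} with hU
  have heq : hitBelow κ r₀ (fun ω => (T ω : ℝ≥0∞)) ω
      = T ω + sInf ((fun u : ℝ≥0 => (u : ℝ≥0∞)) '' U) := by
    simp [hitBelow, hU]
  have hne : U.Nonempty := by
    by_contra hemp
    rw [not_nonempty_iff_eq_empty] at hemp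
    rw [heq, hemp] at hfin
    simp at hfin
  have hcont' : Continuous fun u => κ (T ω + u) ω := hcont.comp (continuous_const.add continuous_id)
  have hclosed : IsClosed U := isClosed_le hcont' continuous_const
  have hmem : sInf U ∈ U := hclosed.csInf_mem hne (OrderBot.bddBelow U)
  have hval : hitBelow κ r₀ (fun ω => (T ω : ℝ≥0∞)) ω = ((T ω + sInf U : ℝ≥0) : ℝ≥0∞) := by
    rw [heq, sInf_image, ← ENNReal.coe_sInf hne, ENNReal.coe_add]
  rw [hval, ENNReal.toNNReal_coe]
  obtain ⟨u, hu, hu'⟩ : r₀ ∈ (fun u => κ (T ω + u) ω) '' Icc 0 (sInf U) :=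
    intermediate_value_Icc' (zero_le (a := sInf U)) hcont'.continuousOn
      ⟨hmem, by simpa using hT.le⟩
  have : u = sInf U := le_antisymm hu.2 (csInf_le (OrderBot.bddBelow U) hu'.le)
  rw [← this]
  exact hu'

theorem stoppedV_zero (κ : ℝ≥0 → Ω → ℝ≥0) (V : ℝ≥0 → ℝ) (r₀ r : ℝ≥0) (T : Ω → ℝ≥0) (ω : Ω) :
    stoppedV κ V r₀ r (fun ω => (T ω : ℝ≥0∞)) 0 ω = V (κ (T ω) ω) := by
  have : (T ω : ℝ≥0∞) ≤ exitTime κ r₀ r (fun ω => (T ω : ℝ≥0∞)) ω :=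
    le_min le_self_add le_self_add
  simp [stoppedV, this]

theorem le_stoppedV {κ : ℝ≥0 → Ω → ℝ≥0} {V : ℝ≥0 → ℝ} {r₀ r : ℝ≥0} {T : Ω → ℝ≥0} {ω : Ω}
    {t : ℝ≥0} {c : ℝ} (hcont : Continuous fun t => κ t ω) (hT : r₀ < κ (T ω) ω)
    (hr : ∀ s ≤ T ω + t, κ s ω < r) (hc : c ≤ V r₀) (hct : c ≤ V (κ (T ω + t) ω)) :
    c ≤ stoppedV κ V r₀ r (fun ω => (T ω : ℝ≥0∞)) t ω := by
  have habove := le_hitAbove hr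
  rw [stoppedV, exitTime]
  rcases le_or_gt ((t : ℝ≥0∞) + T ω) (hitBelow κ r₀ (fun ω => (T ω : ℝ≥0∞)) ω) with h | h
  · rw [min_eq_left (le_min h habove), ← ENNReal.coe_add, ENNReal.toNNReal_coe, add_comm]
    exact hct
  · rw [min_eq_left (h.le.trans habove), min_eq_right h.le,
      apply_toNNReal_hitBelow hcont hT h.ne_top]
    exact hc

theorem stoppedSigma_le {m0 : MeasurableSpace Ω} (ℱ : Filtration ℝ≥0 m0) {T : Ω → ℝ≥0∞}
    {N : ℝ≥0} (hT : ∀ ω, T ω ≤ N) : stoppedSigma ℱ T ≤ m0 := by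
  refine MeasurableSpace.generateFrom_le fun A hA => ?_
  have h := ℱ.le N _ (hA N)
  rwa [show {ω | T ω ≤ (N : ℝ≥0∞)} = univ from eq_univ_of_forall hT, inter_univ] at h

/-- For a stopping time `T` with finitely many values, an event about `κ` at time `T + s`, `s ≤ t`,
is known at time `T + t`. -/
theorem measurableSet_stoppedSigma_preimage {m0 : MeasurableSpace Ω} {ℱ : Filtration ℝ≥0 m0}
    {κ : ℝ≥0 → Ω → ℝ≥0} (hadapt : ∀ t : ℝ≥0, Measurable[ℱ t] (κ t))
    {T : Ω → ℝ≥0} {F : Finset ℝ≥0} (hTF : ∀ ω, T ω ∈ F)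
    (hT : IsStoppingTimeE ℱ fun ω => (T ω : ℝ≥0∞)) {s t : ℝ≥0} (hst : s ≤ t) {W : Set ℝ≥0}
    (hW : MeasurableSet W) :
    MeasurableSet[stoppedSigma ℱ fun ω => (T ω : ℝ≥0∞) + (t : ℝ≥0∞)]
      {ω | κ (T ω + s) ω ∈ W} := by
  have hT' : ∀ u : ℝ≥0, MeasurableSet[ℱ u] {ω | T ω ≤ u} := fun u => by simpa using hT u
  have hTeq : ∀ τ : ℝ≥0, MeasurableSet[ℱ τ] {ω | T ω = τ} := by
    intro τ
    have : {ω | T ω = τ} = {ω | T ω ≤ τ} \ ⋃ σ ∈ F.filter (· < τ), {ω | T ω ≤ σ} := by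
      ext ω
      simp only [mem_ofPred_eq, Set.mem_sdiff, mem_iUnion, Finset.mem_filter, exists_prop, not_exists,
        not_and, not_le, and_imp]
      constructor
      · rintro rfl
        exact ⟨le_rfl, fun σ _ h => h⟩
      · rintro ⟨h1, h2⟩
        by_contra hne
        exact lt_irrefl _ (h2 (T ω) (hTF ω) (lt_of_le_of_ne h1 hne))
    rw [this]
    refine (hT' τ).diff (Finset.measurableSet_biUnion _ fun σ hσ => ?_)
    exact ℱ.mono (Finset.mem_filter.1 hσ).2.le _ (hT' σ)
  refine MeasurableSpace.measurableSet_generateFrom fun u => ?_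
  have : {ω | κ (T ω + s) ω ∈ W} ∩ {ω | (T ω : ℝ≥0∞) + (t : ℝ≥0∞) ≤ (u : ℝ≥0∞)}
      = ⋃ τ ∈ F.filter (fun τ => τ + t ≤ u), {ω | T ω = τ} ∩ κ (τ + s) ⁻¹' W := by
    ext ω
    simp only [mem_inter_iff, mem_ofPred_eq, mem_iUnion, Finset.mem_filter, exists_prop,
      ← ENNReal.coe_add, ENNReal.coe_le_coe, mem_preimage]
    constructor
    · exact fun ⟨h1, h2⟩ => ⟨T ω, ⟨hTF ω, h2⟩, rfl, h1⟩
    · rintro ⟨τ, ⟨-, h2⟩, rfl, h1⟩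
      exact ⟨h1, h2⟩
  rw [this]
  refine Finset.measurableSet_biUnion _ fun τ hτ => ?_
  have hle := (Finset.mem_filter.1 hτ).2
  have hτu : τ ≤ u := le_self_add.trans hle
  have hτs : τ + s ≤ u := by
    refine le_trans ?_ hle
    gcongr
  exact (ℱ.mono hτu _ (hTeq τ)).inter (ℱ.mono hτs _ (hadapt _ hW))

/-- The defining inequality of a supermartingale, integrated over an event of the past. -/
theorem setIntegral_le_of_condExp_le {m m0 : MeasurableSpace Ω} {μ : Measure Ω}
    [IsFiniteMeasure μ] (hm : m ≤ m0) {X Y : Ω → ℝ} (hX : Integrable X μ) (hY : Integrable Y μ)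
    (h : μ[Y | m] ≤ᵐ[μ] X) {D : Set Ω} (hD : MeasurableSet[m] D) :
    ∫ ω in D, Y ω ∂μ ≤ ∫ ω in D, X ω ∂μ := by
  rw [← setIntegral_condExp hm hY hD]
  exact setIntegral_mono_ae integrable_condExp.integrableOn hX.integrableOn h

/-- The first time in `F` at which `κ` exceeds `R`, and the maximum of `F` if there is none. -/
noncomputable def firstPassage (κ : ℝ≥0 → Ω → ℝ≥0) (R : ℝ≥0) (F : Finset ℝ≥0) (ω : Ω) : ℝ≥0 :=
  (insert (F.sup id) (F.filter fun τ => R < κ τ ω)).min' (Finset.insert_nonempty _ _)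

theorem firstPassage_mem (κ : ℝ≥0 → Ω → ℝ≥0) (R : ℝ≥0) (F : Finset ℝ≥0) (ω : Ω) :
    firstPassage κ R F ω ∈ insert (F.sup id) F :=
  Finset.insert_subset_insert _ (Finset.filter_subset _ _) (Finset.min'_mem _ _)

theorem lt_apply_firstPassage {κ : ℝ≥0 → Ω → ℝ≥0} {R : ℝ≥0} {F : Finset ℝ≥0} {ω : Ω}
    (h : ∃ τ ∈ F, R < κ τ ω) : R < κ (firstPassage κ R F ω) ω := by
  obtain ⟨τ, hτ, hR⟩ := h
  have hmem := Finset.min'_mem (insert (F.sup id) (F.filter fun τ => R < κ τ ω))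
    (Finset.insert_nonempty _ _)
  have hle : firstPassage κ R F ω ≤ τ :=
    Finset.min'_le _ _ (Finset.mem_insert_of_mem (Finset.mem_filter.2 ⟨hτ, hR⟩))
  rcases Finset.mem_insert.1 hmem with h | h
  · have hτle : τ ≤ F.sup id := Finset.le_sup (f := id) hτ
    have : firstPassage κ R F ω = τ := le_antisymm hle (hτle.trans h.ge)
    rwa [this]
  · exact (Finset.mem_filter.1 h).2

theorem isStoppingTimeE_firstPassage {m0 : MeasurableSpace Ω} {ℱ : Filtration ℝ≥0 m0}
    {κ : ℝ≥0 → Ω → ℝ≥0} (hadapt : ∀ t : ℝ≥0, Measurable[ℱ t] (κ t)) (R : ℝ≥0)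
    (F : Finset ℝ≥0) : IsStoppingTimeE ℱ fun ω => (firstPassage κ R F ω : ℝ≥0∞) := by
  intro t
  have : {ω | (firstPassage κ R F ω : ℝ≥0∞) ≤ (t : ℝ≥0∞)}
      = {_ω | F.sup id ≤ t} ∪ ⋃ τ ∈ F.filter (· ≤ t), κ τ ⁻¹' Ioi R := by
    ext ω
    simp only [mem_ofPred_eq, ENNReal.coe_le_coe, mem_union, mem_iUnion, Finset.mem_filter,
      exists_prop, mem_preimage, mem_Ioi, firstPassage]
    constructor
    · intro h
      rcases Finset.mem_insert.1 (Finset.min'_mem (insert (F.sup id)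
        (F.filter fun τ => R < κ τ ω)) (Finset.insert_nonempty _ _)) with h' | h'
      · exact Or.inl (h'.ge.trans h)
      · obtain ⟨h1, h2⟩ := Finset.mem_filter.1 h'
        exact Or.inr ⟨_, ⟨h1, h⟩, h2⟩
    · rintro (h | ⟨τ, ⟨h1, h2⟩, h3⟩)
      · exact (Finset.min'_le _ _ (Finset.mem_insert_self _ _)).trans h
      · exact (Finset.min'_le _ _
          (Finset.mem_insert_of_mem (Finset.mem_filter.2 ⟨h1, h3⟩))).trans h2
  rw [this]
  refine (MeasurableSet.const _).union (Finset.measurableSet_biUnion _ fun τ hτ => ?_)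
  exact ℱ.mono (Finset.mem_filter.1 hτ).2 _ (hadapt τ measurableSet_Ioi)


theorem mul_measureReal_iUnion_le_of_monotone {m0 : MeasurableSpace Ω} {μ : Measure Ω}
    [IsFiniteMeasure μ] {S : ℕ → Set Ω} (hS : Monotone S) {c I : ℝ}
    (h : ∀ n, c * μ.real (S n) ≤ I) : c * μ.real (⋃ n, S n) ≤ I :=
  le_of_tendsto (((ENNReal.tendsto_toReal (measure_ne_top μ _)).comp
    (tendsto_measure_iUnion_atTop hS)).const_mul c) (Eventually.of_forall h)

section Transience

variable {m0 : MeasurableSpace Ω} {μ : Measure Ω} [IsProbabilityMeasure μ]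
  {ℱ : Filtration ℝ≥0 m0} {κ : ℝ≥0 → Ω → ℝ≥0} {V : ℝ≥0 → ℝ} {r₀ : ℝ≥0} {T : Ω → ℝ≥0}
  {F : Finset ℝ≥0} {c : ℝ}

/-- The maximal inequality along a grid of times after `T`. -/
theorem mul_measureReal_exists_grid_le (hadapt : ∀ t : ℝ≥0, Measurable[ℱ t] (κ t))
    (hcont : ∀ ω, Continuous fun t => κ t ω)
    (hVcont : Continuous V) (hVpos : ∀ x, 0 < V x) (hTF : ∀ ω, T ω ∈ F)
    (hT : IsStoppingTimeE ℱ fun ω => (T ω : ℝ≥0∞))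
    (hsup : ∀ r : ℝ≥0, r₀ < r →
      (∀ t : ℝ≥0, Integrable (stoppedV κ V r₀ r (fun ω => (T ω : ℝ≥0∞)) t) μ) ∧
        ∀ s t : ℝ≥0, s ≤ t →
          μ[stoppedV κ V r₀ r (fun ω => (T ω : ℝ≥0∞)) t |
              stoppedSigma ℱ (fun ω => (T ω : ℝ≥0∞) + (s : ℝ≥0∞))]
            ≤ᵐ[μ] stoppedV κ V r₀ r (fun ω => (T ω : ℝ≥0∞)) s)
    (hc : 0 ≤ c) (hcV : c ≤ V r₀) (δ : ℝ≥0) (K : ℕ) :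
    c * μ.real {ω | r₀ < κ (T ω) ω ∧ ∃ j < K, c ≤ V (κ (T ω + j * δ) ω)}
      ≤ ∫ ω, V (κ (T ω) ω) ∂μ := by
  set S : ℕ → Set Ω := fun n =>
    {ω | r₀ < κ (T ω) ω ∧ ∀ s ≤ T ω + K * δ, κ s ω < r₀ + 1 + n} ∩
      {ω | ∃ j < K, ω ∈ {ω | κ (T ω + j * δ) ω ∈ V ⁻¹' Ici c}} with hS
  have hW : MeasurableSet (V ⁻¹' Ici c) := hVcont.measurable measurableSet_Ici
  have hσ : ∀ t : ℝ≥0, stoppedSigma ℱ (fun ω => (T ω : ℝ≥0∞) + (t : ℝ≥0∞)) ≤ m0 := by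
    refine fun t => stoppedSigma_le ℱ (N := F.sup id + t) fun ω => ?_
    rw [← ENNReal.coe_add, ENNReal.coe_le_coe]
    gcongr
    exact Finset.le_sup (f := id) (hTF ω)
  have hSmono : Monotone S := by
    rintro n m hnm ω ⟨⟨h1, h2⟩, h3⟩
    refine ⟨⟨h1, fun s hs => (h2 s hs).trans_le ?_⟩, h3⟩
    gcongr
  have hbound : ∀ n, c * μ.real (S n) ≤ ∫ ω, V (κ (T ω) ω) ∂μ := by
    intro n
    obtain ⟨hint, hcond⟩ := hsup (r₀ + 1 + n) (by
      rw [add_assoc]; exact lt_add_of_pos_right _ (by positivity))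
    have hmeas : ∀ j k : ℕ, j ≤ k →
        MeasurableSet[stoppedSigma ℱ fun ω => (T ω : ℝ≥0∞) + ((k * δ : ℝ≥0) : ℝ≥0∞)]
          {ω | κ (T ω + j * δ) ω ∈ V ⁻¹' Ici c} := fun j k hjk =>
      measurableSet_stoppedSigma_preimage hadapt hTF hT (by gcongr) hW
    have h := mul_measureReal_inter_exists_le (μ := μ)
      (X := fun k => stoppedV κ V r₀ (r₀ + 1 + n) (fun ω => (T ω : ℝ≥0∞)) (k * δ))
      (B := fun j => {ω | κ (T ω + j * δ) ω ∈ V ⁻¹' Ici c}) (c := c) (K := K)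
      (E := {ω | r₀ < κ (T ω) ω ∧ ∀ s ≤ T ω + K * δ, κ s ω < r₀ + 1 + n})
      (fun k => hint _) (fun k ω => (hVpos _).le) (fun k => hσ _ _ (hmeas k k le_rfl))
      (fun k => ?_) hc ?_
    · simpa only [Nat.cast_zero, zero_mul, stoppedV_zero] using h
    · refine setIntegral_le_of_condExp_le (hσ (k * δ)) (hint _) (hint _)
        (hcond _ _ (by gcongr; exact k.le_succ)) ?_
      have : {ω | ∀ j ≤ k, ω ∉ {ω | κ (T ω + j * δ) ω ∈ V ⁻¹' Ici c}}
          = ⋂ j, ⋂ (_ : j ≤ k), {ω | κ (T ω + j * δ) ω ∈ V ⁻¹' Ici c}ᶜ := by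
        ext; simp
      rw [this]
      exact MeasurableSet.iInter fun j => MeasurableSet.iInter fun hj => (hmeas j k hj).compl
    · rintro k hk ω ⟨⟨h1, h2⟩, h3⟩
      refine le_stoppedV (hcont ω) h1 (fun s hs => h2 s (hs.trans ?_)) hcV h3
      gcongr
  have hunion : {ω | r₀ < κ (T ω) ω ∧ ∃ j < K, c ≤ V (κ (T ω + j * δ) ω)} ⊆ ⋃ n, S n := by
    rintro ω ⟨h1, h2⟩
    obtain ⟨b, hb⟩ := (isCompact_Icc (a := (0 : ℝ≥0)) (b := T ω + K * δ)).bddAbove_image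
      (hcont ω).continuousOn
    obtain ⟨n, hn⟩ := exists_nat_gt b
    refine mem_iUnion.2 ⟨n, ⟨h1, fun s hs => ?_⟩, h2⟩
    exact ((hb (mem_image_of_mem _ ⟨zero_le, hs⟩)).trans_lt hn).trans_le le_add_self
  refine le_trans ?_ (mul_measureReal_iUnion_le_of_monotone hSmono hbound)
  exact mul_le_mul_of_nonneg_left (measureReal_mono hunion) hc

theorem tendsto_floor_mul_two_pow_div (u : ℝ≥0) :
    Tendsto (fun m : ℕ => (⌊u * 2 ^ m⌋₊ : ℝ≥0) * (2 ^ m)⁻¹) atTop (nhds u) := by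
  rw [← NNReal.tendsto_coe]
  have h := (tendsto_nat_floor_mul_div_atTop (R := ℝ) u.coe_nonneg).comp
    (tendsto_pow_atTop_atTop_of_one_lt (one_lt_two (α := ℝ)))
  refine h.congr fun m => ?_
  have hfl : ⌊(u : ℝ) * 2 ^ m⌋₊ = ⌊u * 2 ^ m⌋₊ := by
    refine eq_of_forall_le_iff fun n => ?_
    rw [Nat.le_floor_iff (by positivity), Nat.le_floor_iff (by positivity)]
    exact_mod_cast Iff.rfl
  simp [hfl, div_eq_mul_inv]

/-- The maximal inequality over all times after `T`. -/
theorem mul_measureReal_frequently_le (hadapt : ∀ t : ℝ≥0, Measurable[ℱ t] (κ t))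
    (hcont : ∀ ω, Continuous fun t => κ t ω)
    (hVcont : Continuous V) (hVpos : ∀ x, 0 < V x) (hTF : ∀ ω, T ω ∈ F)
    (hT : IsStoppingTimeE ℱ fun ω => (T ω : ℝ≥0∞))
    (hsup : ∀ r : ℝ≥0, r₀ < r →
      (∀ t : ℝ≥0, Integrable (stoppedV κ V r₀ r (fun ω => (T ω : ℝ≥0∞)) t) μ) ∧
        ∀ s t : ℝ≥0, s ≤ t →
          μ[stoppedV κ V r₀ r (fun ω => (T ω : ℝ≥0∞)) t |
              stoppedSigma ℱ (fun ω => (T ω : ℝ≥0∞) + (s : ℝ≥0∞))]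
            ≤ᵐ[μ] stoppedV κ V r₀ r (fun ω => (T ω : ℝ≥0∞)) s)
    (hc : 0 ≤ c) (hcV : c ≤ V r₀) :
    c * μ.real {ω | r₀ < κ (T ω) ω ∧ ∃ᶠ t in atTop, c < V (κ t ω)}
      ≤ ∫ ω, V (κ (T ω) ω) ∂μ := by
  set S : ℕ → Set Ω := fun m =>
    {ω | r₀ < κ (T ω) ω ∧ ∃ j < m * 2 ^ m, c ≤ V (κ (T ω + j * (2 ^ m)⁻¹) ω)} with hS
  have hSmono : Monotone S := by
    refine monotone_nat_of_le_succ fun m => ?_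
    rintro ω ⟨h1, j, hj, h2⟩
    refine ⟨h1, 2 * j, ?_, ?_⟩
    · rw [pow_succ]
      nlinarith [Nat.zero_le (2 ^ m)]
    · have : ((2 * j : ℕ) : ℝ≥0) * (2 ^ (m + 1))⁻¹ = j * (2 ^ m)⁻¹ := by
        push_cast
        field_simp
        ring
      rwa [this]
  have hunion : {ω | r₀ < κ (T ω) ω ∧ ∃ᶠ t in atTop, c < V (κ t ω)} ⊆ ⋃ m, S m := by
    rintro ω ⟨h1, h2⟩
    obtain ⟨t, ht, htV⟩ := (h2.and_eventually (eventually_ge_atTop (T ω))).exists.imp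
      fun t h => And.symm h
    obtain ⟨u, rfl⟩ := exists_add_of_le ht
    have hcontu : Continuous fun u => V (κ (T ω + u) ω) :=
      hVcont.comp ((hcont ω).comp (continuous_const.add continuous_id))
    have hev := ((hcontu.tendsto u).comp (tendsto_floor_mul_two_pow_div u)).eventually_const_lt htV
    obtain ⟨n, hn⟩ := exists_nat_gt u
    obtain ⟨m, hm, hnm⟩ := (hev.and (eventually_ge_atTop n)).exists
    refine mem_iUnion.2 ⟨m, h1, _, ?_, hm.le⟩
    rw [Nat.floor_lt (by positivity)]
    push_cast
    have : u < m := hn.trans_le (by exact_mod_cast hnm)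
    gcongr
  refine le_trans ?_ (mul_measureReal_iUnion_le_of_monotone hSmono fun m =>
    mul_measureReal_exists_grid_le hadapt hcont hVcont hVpos hTF hT hsup hc hcV _ _)
  exact mul_le_mul_of_nonneg_left (measureReal_mono hunion) hc

end Transience

theorem exists_lt_of_limsup_eq_top {f : ℝ≥0 → ℝ≥0} (hf : Continuous f)
    (h : limsup (fun t => (f t : ℝ≥0∞)) atTop = ⊤) (R : ℝ≥0) :
    ∃ n, R < f (TopologicalSpace.denseSeq ℝ≥0 n) := by
  have hfreq : ∃ᶠ t in atTop, (R : ℝ≥0∞) < f t :=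
    frequently_lt_of_lt_limsup (by isBoundedDefault) (by rw [h]; exact ENNReal.coe_lt_top)
  obtain ⟨t, ht⟩ := hfreq.exists
  exact (TopologicalSpace.denseRange_denseSeq ℝ≥0).exists_mem_open
    (isOpen_lt continuous_const hf) ⟨t, ENNReal.coe_lt_coe.1 ht⟩

theorem exists_forall_le_of_tendsto_zero {V : ℝ≥0 → ℝ} (hVcont : Continuous V)
    (hVzero : Tendsto V atTop (nhds 0)) : ∃ M, 0 ≤ M ∧ ∀ x, V x ≤ M := by
  obtain ⟨R, hR⟩ := eventually_atTop.1 (hVzero.eventually_le_const one_pos)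
  obtain ⟨b, hb⟩ := (isCompact_Icc (a := (0 : ℝ≥0)) (b := R)).bddAbove_image hVcont.continuousOn
  refine ⟨max b 1, zero_le_one.trans (le_max_right _ _), fun x => ?_⟩
  rcases le_total x R with h | h
  · exact (hb (mem_image_of_mem _ ⟨zero_le, h⟩)).trans (le_max_left _ _)
  · exact (hR x h).trans (le_max_right _ _)

/-- A positive continuous function is small only near infinity. -/
theorem tendsto_atTop_of_eventually_le {V : ℝ≥0 → ℝ} (hVcont : Continuous V)
    (hVpos : ∀ x, 0 < V x) {f : ℝ≥0 → ℝ≥0} {a : ℝ}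
    (h : ∀ n : ℕ, ∀ᶠ t in atTop, V (f t) ≤ a / (n + 1)) : Tendsto f atTop atTop := by
  refine tendsto_atTop.2 fun b => ?_
  obtain ⟨x, -, hx⟩ := (isCompact_Icc (a := (0 : ℝ≥0)) (b := b)).exists_isMinOn
    (nonempty_Icc.2 zero_le) hVcont.continuousOn
  have hlim : Tendsto (fun n : ℕ => a / ((n : ℝ) + 1)) atTop (nhds 0) :=
    tendsto_const_nhds.div_atTop (tendsto_natCast_atTop_atTop.atTop_add tendsto_const_nhds)
  obtain ⟨n, hn⟩ := (hlim.eventually_lt_const (hVpos x)).exists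
  filter_upwards [h n] with t ht
  by_contra! hlt
  exact (ht.trans_lt hn).not_ge (hx ⟨zero_le, hlt.le⟩)

/-- Under the supermartingale hypothesis, `V (κ_t)` does not exceed a small positive level
at arbitrarily large times. -/
theorem ae_eventually_le {m0 : MeasurableSpace Ω} {μ : Measure Ω} [IsProbabilityMeasure μ]
    (ℱ : Filtration ℝ≥0 m0)
    (κ : ℝ≥0 → Ω → ℝ≥0)
    (hadapt : ∀ t : ℝ≥0, Measurable[ℱ t] (κ t))
    (hcont : ∀ ω, Continuous fun t => κ t ω)
    (hlimsup : ∀ᵐ ω ∂μ, Filter.limsup (fun t => (κ t ω : ℝ≥0∞)) atTop = ⊤)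
    (V : ℝ≥0 → ℝ) (hVcont : Continuous V) (hVpos : ∀ x, 0 < V x)
    (hVzero : Tendsto V atTop (nhds 0)) (r₀ : ℝ≥0)
    (hsup : ∀ T : Ω → ℝ≥0∞, IsStoppingTimeE ℱ T → (∀ᵐ ω ∂μ, T ω ≠ ⊤) →
      ∀ r : ℝ≥0, r₀ < r →
        (∀ t : ℝ≥0, Integrable (stoppedV κ V r₀ r T t) μ) ∧
          ∀ s t : ℝ≥0, s ≤ t →
            μ[stoppedV κ V r₀ r T t | stoppedSigma ℱ (fun ω => T ω + (s : ℝ≥0∞))]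
              ≤ᵐ[μ] stoppedV κ V r₀ r T s)
    {c : ℝ} (hc : 0 < c) (hcV : c ≤ V r₀) :
    ∀ᵐ ω ∂μ, ∀ᶠ t in atTop, V (κ t ω) ≤ c := by
  set H : Set Ω := {ω | ∃ᶠ t in atTop, c < V (κ t ω)} with hH
  suffices hH0 : μ.real H = 0 by
    rw [measureReal_eq_zero_iff] at hH0
    filter_upwards [measure_eq_zero_iff_ae_notMem.1 hH0] with ω hω
    simpa [hH, not_frequently] using hω
  obtain ⟨M, hM0, hM⟩ := exists_forall_le_of_tendsto_zero hVcont hVzero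
  suffices hε : ∀ ε > 0, c * μ.real H ≤ ε by
    have h0 : c * μ.real H ≤ 0 := le_of_forall_gt_imp_ge_of_dense hε
    exact le_antisymm (nonpos_of_mul_nonpos_right h0 hc) measureReal_nonneg
  intro ε hε
  obtain ⟨R', hR'⟩ := eventually_atTop.1 (hVzero.eventually_le_const hε)
  set R := max R' r₀ with hR
  set F : ℕ → Finset ℝ≥0 := fun n => (Finset.range n).image (TopologicalSpace.denseSeq ℝ≥0)
  set A : ℕ → Set Ω := fun n => {ω | ∃ τ ∈ F n, R < κ τ ω} with hA
  have hAmeas : ∀ n, MeasurableSet (A n) := by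
    intro n
    have : A n = ⋃ τ ∈ F n, κ τ ⁻¹' Ioi R := by ext; simp [hA]
    rw [this]
    exact Finset.measurableSet_biUnion _ fun τ _ => ℱ.le τ _ (hadapt τ measurableSet_Ioi)
  have hAmono : Monotone A := by
    rintro n m hnm ω ⟨τ, hτ, h⟩
    exact ⟨τ, Finset.image_subset_image (Finset.range_mono hnm) hτ, h⟩
  have hAunion : μ (⋃ n, A n) = 1 := by
    rw [← measure_univ (μ := μ)]
    refine measure_congr (eventuallyEq_univ.2 ?_)
    filter_upwards [hlimsup] with ω hω
    obtain ⟨n, hn⟩ := exists_lt_of_limsup_eq_top (hcont ω) hω R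
    exact mem_iUnion.2 ⟨n + 1, _,
      Finset.mem_image_of_mem _ (Finset.mem_range.2 n.lt_succ_self), hn⟩
  have hAlim : Tendsto (fun n => μ.real (A n)) atTop (nhds 1) := by
    have := (ENNReal.tendsto_toReal (measure_ne_top μ _)).comp
      (tendsto_measure_iUnion_atTop (μ := μ) hAmono)
    rwa [hAunion, ENNReal.toReal_one] at this
  have hbound : ∀ n, c * μ.real H ≤ ε + (M + c) * (1 - μ.real (A n)) := by
    intro n
    have hTime := isStoppingTimeE_firstPassage hadapt R (F n)
    have h := mul_measureReal_frequently_le hadapt hcont hVcont hVpos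
      (firstPassage_mem κ R (F n)) hTime
      (hsup _ hTime (Eventually.of_forall fun ω => ENNReal.coe_ne_top)) hc.le hcV
    have hcompl : μ.real (A n)ᶜ = 1 - μ.real (A n) := by
      rw [measureReal_compl (hAmeas n), probReal_univ]
    have hsub : H ⊆ {ω | r₀ < κ (firstPassage κ R (F n) ω) ω ∧ ∃ᶠ t in atTop, c < V (κ t ω)}
        ∪ (A n)ᶜ := by
      intro ω hω
      by_cases hωA : ω ∈ A n
      · exact Or.inl ⟨(le_max_right R' r₀).trans_lt (lt_apply_firstPassage hωA), hω⟩
      · exact Or.inr hωA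
    have hHle := mul_le_mul_of_nonneg_left
      ((measureReal_mono (μ := μ) hsub).trans (measureReal_union_le _ _)) hc.le
    have hind : Integrable (fun ω => ε + (A n)ᶜ.indicator (fun _ => M) ω) μ :=
      (integrable_const _).add ((integrable_const _).indicator (hAmeas n).compl)
    have hI : ∫ ω, V (κ (firstPassage κ R (F n) ω) ω) ∂μ ≤ ε + M * (1 - μ.real (A n)) := by
      calc ∫ ω, V (κ (firstPassage κ R (F n) ω) ω) ∂μ
          ≤ ∫ ω, (ε + (A n)ᶜ.indicator (fun _ => M) ω) ∂μ := by
            refine integral_mono_of_nonneg (Eventually.of_forall fun ω => (hVpos _).le) hind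
              (Eventually.of_forall fun ω => ?_)
            by_cases hωA : ω ∈ A n
            · simpa [hωA] using hR' _ ((le_max_left R' r₀).trans (lt_apply_firstPassage hωA).le)
            · simpa [hωA] using (hM _).trans (le_add_of_nonneg_left hε.le)
        _ = ε + M * (1 - μ.real (A n)) := by
            rw [integral_add (integrable_const _)
              ((integrable_const _).indicator (hAmeas n).compl),
              integral_indicator_const _ (hAmeas n).compl, hcompl]
            simp [mul_comm]
    rw [hcompl] at hHle
    linarith
  have hlim : Tendsto (fun n => ε + (M + c) * (1 - μ.real (A n))) atTop
      (nhds (ε + (M + c) * (1 - 1))) :=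
    ((hAlim.const_sub 1).const_mul _).const_add _
  simpa using ge_of_tendsto' hlim hbound

/-- **Transience criterion** (Lemma 3.5): if `V > 0` is continuous with `V(x) → 0` as
`x → ∞`, `κ` is a continuous adapted nonnegative process with `limsup_{t→∞} κ_t = ∞`
a.s., and for some `r₀ > 0`, every a.s. finite stopping time `T` and every `r > r₀` the
process `(V(κ_{(t+T) ∧ S_{r,T}}))_{t ≥ 0}` is an `(F_{t+T})`-supermartingale, then
`κ_t → ∞` almost surely. -/
theorem transience_criterion
    {m0 : MeasurableSpace Ω} {μ : Measure Ω} [IsProbabilityMeasure μ]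
    (ℱ : Filtration ℝ≥0 m0)
    (κ : ℝ≥0 → Ω → ℝ≥0)
    (hadapt : ∀ t : ℝ≥0, Measurable[ℱ t] (κ t))
    (hcont : ∀ ω, Continuous fun t => κ t ω)
    (hlimsup : ∀ᵐ ω ∂μ, Filter.limsup (fun t => (κ t ω : ℝ≥0∞)) atTop = ⊤)
    (V : ℝ≥0 → ℝ) (hVcont : Continuous V) (hVpos : ∀ x, 0 < V x)
    (hVzero : Tendsto V atTop (nhds 0))
    (r₀ : ℝ≥0) (hr₀ : 0 < r₀)
    (hsup : ∀ T : Ω → ℝ≥0∞, IsStoppingTimeE ℱ T → (∀ᵐ ω ∂μ, T ω ≠ ⊤) →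
      ∀ r : ℝ≥0, r₀ < r →
        (∀ t : ℝ≥0, Integrable (stoppedV κ V r₀ r T t) μ) ∧
          ∀ s t : ℝ≥0, s ≤ t →
            μ[stoppedV κ V r₀ r T t | stoppedSigma ℱ (fun ω => T ω + (s : ℝ≥0∞))]
              ≤ᵐ[μ] stoppedV κ V r₀ r T s) :
    μ {ω | Tendsto (fun t => κ t ω) atTop atTop} = 1 := by
  have hpos := hVpos r₀
  have hall : ∀ᵐ ω ∂μ, ∀ n : ℕ, ∀ᶠ t in atTop, V (κ t ω) ≤ V r₀ / (n + 1) :=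
    ae_all_iff.2 fun n => ae_eventually_le ℱ κ hadapt hcont hlimsup V hVcont hVpos hVzero r₀ hsup
      (by positivity) (div_le_self hpos.le (by simp))
  rw [← measure_univ (μ := μ)]
  refine measure_congr (eventuallyEq_univ.2 ?_)
  filter_upwards [hall] with ω hω
  exact tendsto_atTop_of_eventually_le hVcont hVpos hω
end

section
/- Asymptotics of the Σ-Laplacian of the Lyapunov function f_{w,γ} (first claim of Lemma 2.1 of the paper). Assume (D2) and (C2), and fix γ ∈ ℝ and w ∈ ℝ∖{0}. Then there exists a function e : D → ℝ with lim_{x→∞} sup_{y : (x,y)∈D} |e(x,y)| = 0 such that for all z = (x,y) ∈ D with x sufficiently large, Δ_Σ f_{w,γ}(z) = γ·f_{w,1}(z)^{γ−2}·(σ₁²(γ−1) + σ₂²(1−w) + e(z)). -/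
open Real Filter Set Topology

noncomputable section

/-- Squared Euclidean norm of the `y`-part of `z = (x, y) ∈ ℝ × ℝ^d`. -/
def ynormSq (d : ℕ) (z : Fin (d + 1) → ℝ) : ℝ := ∑ i : Fin d, (z i.succ) ^ 2

/-- Euclidean norm of the `y`-part of `z = (x, y) ∈ ℝ × ℝ^d`. -/
def ynorm (d : ℕ) (z : Fin (d + 1) → ℝ) : ℝ := Real.sqrt (ynormSq d z)

/-- The generalized parabolic domain `D = {(x,y) ∈ [0,∞) × ℝ^d : ‖y‖ ≤ b(x)}`. -/
def Dom (d : ℕ) (b : ℝ → ℝ) : Set (Fin (d + 1) → ℝ) :=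
  {z | 0 ≤ z 0 ∧ ynorm d z ≤ b (z 0)}

/-- The boundary `∂D = {(x,y) ∈ D : ‖y‖ = b(x)}`. -/
def Bdry (d : ℕ) (b : ℝ → ℝ) : Set (Fin (d + 1) → ℝ) :=
  {z | 0 ≤ z 0 ∧ ynorm d z = b (z 0)}

/-- The constant `k_w = 1 + sup_{x ≥ 0} (|w(1-w)|^{1/2} b(x) − x)`. -/
def kw (b : ℝ → ℝ) (w : ℝ) : ℝ :=
  1 + sSup ((fun x => Real.sqrt |w * (1 - w)| * b x - x) '' Ici (0 : ℝ))

/-- The Lyapunov function `f_{w,1}`. -/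
def fw1 (d : ℕ) (b : ℝ → ℝ) (w : ℝ) (z : Fin (d + 1) → ℝ) : ℝ :=
  (z 0 + kw b w) *
    (1 + w * (1 - w) * ynormSq d z / (2 * (z 0 + kw b w) ^ 2)) ^ (1 / w)

/-- The Lyapunov function `f_{w,γ} = (f_{w,1})^γ`. -/
def fw (d : ℕ) (b : ℝ → ℝ) (w γ : ℝ) (z : Fin (d + 1) → ℝ) : ℝ := (fw1 d b w z) ^ γ

/-- Assumption (D1) on the boundary function `b`. -/
def AssumpD1 (b : ℝ → ℝ) : Prop :=
  ContinuousOn b (Ici 0) ∧ b 0 = 0 ∧ (∀ x : ℝ, 0 < x → 0 < b x) ∧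
    ContDiffOn ℝ 2 b (Ioi 0) ∧
    (∃ c : ℝ, 0 < c ∧ ∀ᶠ x in 𝓝[>] (0 : ℝ), c ≤ b x * deriv b x) ∧
    (∃ L : ℝ, L ≤ 0 ∧
      Tendsto (fun x => deriv (deriv b) x / (deriv b x) ^ 3) (𝓝[>] (0 : ℝ)) (𝓝 L))

/-- Assumption (D2) on the boundary function `b`, with growth exponent `β < 1`. -/
def AssumpD2 (b : ℝ → ℝ) (β : ℝ) : Prop :=
  AssumpD1 b ∧ Tendsto (deriv b) atTop (𝓝 0) ∧
    Tendsto (deriv (deriv b)) atTop (𝓝 0) ∧ β < 1 ∧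
    Tendsto (fun x => x * deriv b x / b x) atTop (𝓝 β)


/-- The `i`-th partial derivative of `f` at `z`. -/
def pderiv (d : ℕ) (f : (Fin (d + 1) → ℝ) → ℝ) (i : Fin (d + 1))
    (z : Fin (d + 1) → ℝ) : ℝ :=
  fderiv ℝ f z (Pi.single i 1)

/-- The `(i,j)` entry of the Hessian matrix `H(f)` of `f` at `z`. -/
def hess (d : ℕ) (f : (Fin (d + 1) → ℝ) → ℝ) (i j : Fin (d + 1))
    (z : Fin (d + 1) → ℝ) : ℝ :=
  fderiv ℝ (fun z' => fderiv ℝ f z' (Pi.single j 1)) z (Pi.single i 1)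

/-- The `Σ`-Laplacian `Δ_Σ f := Tr (Σ · H(f))`. -/
def lapSigma (d : ℕ) (Sig : (Fin (d + 1) → ℝ) → Matrix (Fin (d + 1)) (Fin (d + 1)) ℝ)
    (f : (Fin (d + 1) → ℝ) → ℝ) (z : Fin (d + 1) → ℝ) : ℝ :=
  ∑ i, ∑ j, Sig z i j * hess d f j i z

/-- Assumption (C1) on the diffusion matrix `Σ`: symmetric positive definite values,
bounded, globally Lipschitz and uniformly elliptic on `D`. -/
def AssumpC1 (d : ℕ) (b : ℝ → ℝ)
    (Sig : (Fin (d + 1) → ℝ) → Matrix (Fin (d + 1)) (Fin (d + 1)) ℝ) : Prop :=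
  (∀ z ∈ Dom d b, (Sig z).IsSymm ∧ (Sig z).PosDef) ∧
    (∃ K : ℝ, ∀ z ∈ Dom d b, ∀ i j, |Sig z i j| ≤ K) ∧
    (∃ L : ℝ, ∀ z ∈ Dom d b, ∀ z' ∈ Dom d b, ∀ i j,
      |Sig z i j - Sig z' i j| ≤ L * Real.sqrt (∑ k, (z k - z' k) ^ 2)) ∧
    (∃ δS : ℝ, 0 < δS ∧ ∀ z ∈ Dom d b, ∀ u : Fin (d + 1) → ℝ,
      (∑ i, (u i) ^ 2) = 1 → δS ≤ ∑ i, ∑ j, Sig z i j * u j * u i)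

/-- Assumption (C2): (C1) together with `⟨Σ(z) e_x, e_x⟩ = σ₁² (1 + o_D(1))` and
`Tr Σ(z) − ⟨Σ(z) e_x, e_x⟩ = σ₂² (1 + o_D(1))` as `x → ∞`. -/
def AssumpC2 (d : ℕ) (b : ℝ → ℝ)
    (Sig : (Fin (d + 1) → ℝ) → Matrix (Fin (d + 1)) (Fin (d + 1)) ℝ)
    (σ1sq σ2sq : ℝ) : Prop :=
  AssumpC1 d b Sig ∧ 0 < σ1sq ∧ 0 < σ2sq ∧
    (∀ ε : ℝ, 0 < ε → ∃ x₀ : ℝ, ∀ z ∈ Dom d b, x₀ ≤ z 0 →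
      |Sig z 0 0 - σ1sq| ≤ ε) ∧
    (∀ ε : ℝ, 0 < ε → ∃ x₀ : ℝ, ∀ z ∈ Dom d b, x₀ ≤ z 0 →
      |(∑ i, Sig z i i) - Sig z 0 0 - σ2sq| ≤ ε)

/-- The quadratic polynomial `(x + k)² + c ‖y‖² / 2`. -/
def shiftedQuad (d : ℕ) (k c : ℝ) (z : Fin (d + 1) → ℝ) : ℝ :=
  (z 0 + k) ^ 2 + c / 2 * ynormSq d z

/-- The `i`-th partial derivative of `shiftedQuad`. -/
def shiftedQuadGrad (d : ℕ) (k c : ℝ) (i : Fin (d + 1)) (z : Fin (d + 1) → ℝ) : ℝ :=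
  if i = 0 then 2 * (z 0 + k) else c * z i

/-- The `i`-th partial derivative of `p * log (x + k) + a * log (shiftedQuad d k c)`. -/
def logGrad (d : ℕ) (k c p a : ℝ) (i : Fin (d + 1)) (z : Fin (d + 1) → ℝ) : ℝ :=
  (if i = 0 then p / (z 0 + k) else 0) + a * shiftedQuadGrad d k c i z / shiftedQuad d k c z

/-- The function `(x + k)^p * shiftedQuad^a`, written as an exponential. -/
def powProd (d : ℕ) (k c p a : ℝ) (z : Fin (d + 1) → ℝ) : ℝ :=
  Real.exp (p * Real.log (z 0 + k) + a * Real.log (shiftedQuad d k c z))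

/-- The `(i, j)` second partial derivative of
`p * log (x + k) + a * log (shiftedQuad d k c)`. -/
def logHess (d : ℕ) (k c p a : ℝ) (i j : Fin (d + 1)) (z : Fin (d + 1) → ℝ) : ℝ :=
  (if i = 0 ∧ j = 0 then -p / (z 0 + k) ^ 2 else 0) +
    a * (if i = j then (if j = 0 then 2 else c) else 0) / shiftedQuad d k c z -
    a * shiftedQuadGrad d k c i z * shiftedQuadGrad d k c j z / shiftedQuad d k c z ^ 2

lemma hasFDerivAt_coord (d : ℕ) (i : Fin (d + 1)) (z : Fin (d + 1) → ℝ) :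
    HasFDerivAt (fun z : Fin (d + 1) → ℝ => z i)
      (ContinuousLinearMap.proj (R := ℝ) (φ := fun _ : Fin (d + 1) => ℝ) i) z :=
  hasFDerivAt_apply i z

lemma hasFDerivAt_shiftedQuad (d : ℕ) (k c : ℝ) (z : Fin (d + 1) → ℝ) :
    ∃ D : (Fin (d + 1) → ℝ) →L[ℝ] ℝ, HasFDerivAt (shiftedQuad d k c) D z ∧
      ∀ i, D (Pi.single i 1) = shiftedQuadGrad d k c i z := by
  have h1 := ((hasFDerivAt_coord d 0 z).add_const k).pow 2
  have h2 : HasFDerivAt (ynormSq d) _ z := HasFDerivAt.fun_sum (u := Finset.univ)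
    (fun (i : Fin d) _ => (hasFDerivAt_coord d i.succ z).pow 2)
  refine ⟨_, h1.add (h2.const_mul (c / 2)), fun i => ?_⟩
  refine Fin.cases ?_ (fun i => ?_) i
  · simp [shiftedQuadGrad, Fin.succ_ne_zero]
    ring
  · simp [shiftedQuadGrad, Pi.single_apply, Fin.succ_ne_zero, (Fin.succ_ne_zero _).symm]
    ring

lemma hasFDerivAt_shiftedQuadGrad (d : ℕ) (k c : ℝ) (j : Fin (d + 1)) (z : Fin (d + 1) → ℝ) :
    ∃ D : (Fin (d + 1) → ℝ) →L[ℝ] ℝ, HasFDerivAt (shiftedQuadGrad d k c j) D z ∧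
      ∀ i, D (Pi.single i 1) = if i = j then (if j = 0 then 2 else c) else 0 := by
  by_cases hj : j = 0
  · subst hj
    have h : HasFDerivAt (shiftedQuadGrad d k c 0) _ z :=
      ((hasFDerivAt_coord d 0 z).add_const k).const_mul 2
    exact ⟨_, h, fun i => by simp [Pi.single_apply, eq_comm]⟩
  · have h : HasFDerivAt (shiftedQuadGrad d k c j) _ z :=
      ((hasFDerivAt_coord d j z).const_mul c).congr_of_eventuallyEq
        (Eventually.of_forall fun z => by simp [shiftedQuadGrad, hj])
    exact ⟨_, h, fun i => by simp [Pi.single_apply, eq_comm, hj]⟩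

lemma hasFDerivAt_powProd (d : ℕ) (k c p a : ℝ) (z : Fin (d + 1) → ℝ)
    (hs : z 0 + k ≠ 0) (hq : shiftedQuad d k c z ≠ 0) :
    ∃ D : (Fin (d + 1) → ℝ) →L[ℝ] ℝ, HasFDerivAt (powProd d k c p a) D z ∧
      ∀ i, D (Pi.single i 1) = powProd d k c p a z * logGrad d k c p a i z := by
  obtain ⟨D, hD, hDi⟩ := hasFDerivAt_shiftedQuad d k c z
  have h1 := (((hasFDerivAt_coord d 0 z).add_const k).log hs).const_mul p
  refine ⟨_, (h1.add ((hD.log hq).const_mul a)).exp, fun i => ?_⟩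
  have h0 : (Pi.single i 1 : Fin (d + 1) → ℝ) 0 = if i = 0 then 1 else 0 := by
    simp [Pi.single_apply, eq_comm]
  simp only [powProd, logGrad, Pi.add_apply, add_apply, smul_apply, smul_eq_mul, hDi,
    ContinuousLinearMap.proj_apply, h0]
  split_ifs <;> ring

lemma hasFDerivAt_div (d : ℕ) {f g : (Fin (d + 1) → ℝ) → ℝ}
    {f' g' : (Fin (d + 1) → ℝ) →L[ℝ] ℝ}
    {z : Fin (d + 1) → ℝ} (hf : HasFDerivAt f f' z) (hg : HasFDerivAt g g' z) (h : g z ≠ 0) :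
    HasFDerivAt (fun z => f z / g z) ((g z)⁻¹ • f' - (f z / g z ^ 2) • g') z := by
  simp only [div_eq_mul_inv]
  refine (hf.mul ((hasDerivAt_inv h).comp_hasFDerivAt z hg)).congr_fderiv ?_
  ext v
  simp
  ring

lemma hasFDerivAt_logGrad (d : ℕ) (k c p a : ℝ) (j : Fin (d + 1)) (z : Fin (d + 1) → ℝ)
    (hs : z 0 + k ≠ 0) (hq : shiftedQuad d k c z ≠ 0) :
    ∃ D : (Fin (d + 1) → ℝ) →L[ℝ] ℝ, HasFDerivAt (logGrad d k c p a j) D z ∧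
      ∀ i, D (Pi.single i 1) = logHess d k c p a i j z := by
  obtain ⟨D, hD, hDi⟩ := hasFDerivAt_shiftedQuad d k c z
  obtain ⟨E, hE, hEi⟩ := hasFDerivAt_shiftedQuadGrad d k c j z
  have h1 : ∃ A : (Fin (d + 1) → ℝ) →L[ℝ] ℝ,
      HasFDerivAt (fun z : Fin (d + 1) → ℝ => if j = 0 then p / (z 0 + k) else 0) A z ∧
      ∀ i, A (Pi.single i 1) = if i = 0 ∧ j = 0 then -p / (z 0 + k) ^ 2 else 0 := by
    by_cases hj : j = 0
    · have h := hasFDerivAt_div d (hasFDerivAt_const p z)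
        ((hasFDerivAt_coord d 0 z).add_const k) hs
      simp only [hj, if_true, and_true]
      refine ⟨_, h, fun i => ?_⟩
      by_cases hi : i = 0 <;> simp [hi, eq_comm]
      field_simp
    · simp only [hj, if_false, and_false]
      exact ⟨_, hasFDerivAt_const 0 z, fun i => by simp⟩
  obtain ⟨A, hA, hAi⟩ := h1
  refine ⟨_, hA.add (hasFDerivAt_div d (hE.const_mul a) hD hq), fun i => ?_⟩
  simp only [logHess, add_apply, sub_apply,
    smul_apply, smul_eq_mul, hAi, hDi, hEi]
  rw [add_sub_assoc]
  congr 1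
  field_simp

lemma hess_powProd (d : ℕ) (k c p a : ℝ) (i j : Fin (d + 1)) (z : Fin (d + 1) → ℝ)
    (hs : 0 < z 0 + k) (hq : 0 < shiftedQuad d k c z) :
    hess d (powProd d k c p a) i j z = powProd d k c p a z *
      (logGrad d k c p a i z * logGrad d k c p a j z + logHess d k c p a i j z) := by
  obtain ⟨Q, hQ, -⟩ := hasFDerivAt_shiftedQuad d k c z
  have hev : (fun z' => fderiv ℝ (powProd d k c p a) z' (Pi.single j 1)) =ᶠ[𝓝 z]
      fun z' => powProd d k c p a z' * logGrad d k c p a j z' := by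
    have hs' : ∀ᶠ z' in 𝓝 z, 0 < z' 0 + k :=
      ((hasFDerivAt_coord d 0 z).add_const k).continuousAt.eventually (lt_mem_nhds hs)
    filter_upwards [hs', hQ.continuousAt.eventually (lt_mem_nhds hq)] with z' h1 h2
    obtain ⟨D, hD, hDi⟩ := hasFDerivAt_powProd d k c p a z' h1.ne' h2.ne'
    rw [hD.fderiv, hDi]
  obtain ⟨D, hD, hDi⟩ := hasFDerivAt_powProd d k c p a z hs.ne' hq.ne'
  obtain ⟨E, hE, hEi⟩ := hasFDerivAt_logGrad d k c p a j z hs.ne' hq.ne'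
  have hmul : HasFDerivAt (fun z' => powProd d k c p a z' * logGrad d k c p a j z') _ z :=
    hD.mul hE
  rw [hess, hev.fderiv_eq, hmul.fderiv]
  simp only [add_apply, smul_apply, smul_eq_mul, hDi, hEi]
  ring

lemma hess_congr_of_eventuallyEq (d : ℕ) {f g : (Fin (d + 1) → ℝ) → ℝ} (i j : Fin (d + 1))
    {z : Fin (d + 1) → ℝ} (h : f =ᶠ[𝓝 z] g) : hess d f i j z = hess d g i j z := by
  have h' : (fun z' => fderiv ℝ f z' (Pi.single j 1)) =ᶠ[𝓝 z]
      fun z' => fderiv ℝ g z' (Pi.single j 1) := by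
    filter_upwards [h.eventuallyEq_nhds] with z' hz'
    rw [hz'.fderiv_eq]
  rw [hess, hess, h'.fderiv_eq]

lemma shiftedQuad_eq_mul (d : ℕ) (k c : ℝ) (z : Fin (d + 1) → ℝ) (hs : z 0 + k ≠ 0) :
    shiftedQuad d k c z =
      (z 0 + k) ^ 2 * (1 + c * ynormSq d z / (2 * (z 0 + k) ^ 2)) := by
  rw [shiftedQuad]
  field_simp

lemma fw_eq_powProd (d : ℕ) (b : ℝ → ℝ) (w γ : ℝ) (z : Fin (d + 1) → ℝ)
    (hs : 0 < z 0 + kw b w) (hq : 0 < shiftedQuad d (kw b w) (w * (1 - w)) z) :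
    fw d b w γ z = powProd d (kw b w) (w * (1 - w)) (γ - 2 * γ / w) (γ / w) z := by
  have h := shiftedQuad_eq_mul d (kw b w) (w * (1 - w)) z hs.ne'
  have hu : 0 < 1 + w * (1 - w) * ynormSq d z / (2 * (z 0 + kw b w) ^ 2) := by
    rw [h] at hq
    exact (pos_iff_pos_of_mul_pos hq).mp (by positivity)
  rw [powProd, h, fw, fw1, Real.log_mul (by positivity) hu.ne', Real.log_pow,
    Real.rpow_def_of_pos (mul_pos hs (Real.rpow_pos_of_pos hu _)),
    Real.log_mul hs.ne' (Real.rpow_pos_of_pos hu _).ne', Real.log_rpow hu]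
  congr 1
  push_cast
  ring

lemma hess_fw (d : ℕ) (b : ℝ → ℝ) (w γ : ℝ) (i j : Fin (d + 1)) (z : Fin (d + 1) → ℝ)
    (hs : 0 < z 0 + kw b w) (hq : 0 < shiftedQuad d (kw b w) (w * (1 - w)) z) :
    hess d (fw d b w γ) i j z = fw d b w γ z *
      (logGrad d (kw b w) (w * (1 - w)) (γ - 2 * γ / w) (γ / w) i z *
        logGrad d (kw b w) (w * (1 - w)) (γ - 2 * γ / w) (γ / w) j z +
        logHess d (kw b w) (w * (1 - w)) (γ - 2 * γ / w) (γ / w) i j z) := by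
  obtain ⟨Q, hQ, -⟩ := hasFDerivAt_shiftedQuad d (kw b w) (w * (1 - w)) z
  have hs' : ∀ᶠ z' in 𝓝 z, 0 < z' 0 + kw b w :=
    ((hasFDerivAt_coord d 0 z).add_const _).continuousAt.eventually (lt_mem_nhds hs)
  rw [fw_eq_powProd d b w γ z hs hq, ← hess_powProd _ _ _ _ _ _ _ _ hs hq]
  refine hess_congr_of_eventuallyEq d i j ?_
  filter_upwards [hs', hQ.continuousAt.eventually (lt_mem_nhds hq)] with z' h1 h2
  exact fw_eq_powProd d b w γ z' h1 h2

/-- The filter of points of `D` whose first coordinate tends to infinity. -/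
def domAtTop (d : ℕ) (b : ℝ → ℝ) : Filter (Fin (d + 1) → ℝ) :=
  comap (fun z => z 0) atTop ⊓ 𝓟 (Dom d b)

lemma eventually_domAtTop (d : ℕ) (b : ℝ → ℝ) {P : (Fin (d + 1) → ℝ) → Prop} :
    (∀ᶠ z in domAtTop d b, P z) ↔ ∃ x₀ : ℝ, ∀ z ∈ Dom d b, x₀ ≤ z 0 → P z := by
  rw [domAtTop, eventually_inf_principal, eventually_comap, eventually_atTop]
  constructor
  · rintro ⟨x₀, h⟩
    exact ⟨x₀, fun z hz hx => h _ hx z rfl hz⟩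
  · rintro ⟨x₀, h⟩
    exact ⟨x₀, fun x hx z hzx hz => h z hz (hzx ▸ hx)⟩

lemma tendsto_domAtTop (d : ℕ) (b : ℝ → ℝ) {e : (Fin (d + 1) → ℝ) → ℝ} {L : ℝ} :
    Tendsto e (domAtTop d b) (𝓝 L) ↔
      ∀ ε : ℝ, 0 < ε → ∃ x₀ : ℝ, ∀ z ∈ Dom d b, x₀ ≤ z 0 → |e z - L| ≤ ε := by
  simp_rw [← eventually_domAtTop]
  rw [Metric.nhds_basis_closedBall.tendsto_right_iff]
  simp [Real.dist_eq]

lemma tendsto_div_id_of_tendsto_deriv {b : ℝ → ℝ} (hb : DifferentiableOn ℝ b (Ioi 0))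
    (h : Tendsto (deriv b) atTop (𝓝 0)) : Tendsto (fun x => b x / x) atTop (𝓝 0) := by
  suffices b =o[atTop] (fun x : ℝ => x) from this.tendsto_div_nhds_zero
  rw [Asymptotics.isLittleO_iff]
  intro ε hε
  obtain ⟨X, hX⟩ := eventually_atTop.mp
    ((h.eventually (Metric.closedBall_mem_nhds 0 (half_pos hε))).and (eventually_gt_atTop 0))
  have hX0 : 0 < X := (hX X le_rfl).2
  filter_upwards [eventually_ge_atTop X, eventually_ge_atTop (‖b X‖ / (ε / 2))] with x hx hx2
  have h1 : ‖b x - b X‖ ≤ ε / 2 * ‖x - X‖ :=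
    (convex_Ici X).norm_image_sub_le_of_norm_deriv_le
      (fun y hy => (hb y (hX0.trans_le hy)).differentiableAt (Ioi_mem_nhds (hX0.trans_le hy)))
      (fun y hy => by simpa using (hX y hy).1) self_mem_Ici hx
  rw [div_le_iff₀ (half_pos hε)] at hx2
  have h2 := norm_le_norm_add_norm_sub' (b x) (b X)
  rw [Real.norm_of_nonneg (sub_nonneg.mpr hx)] at h1
  rw [Real.norm_of_nonneg (hX0.le.trans hx)]
  nlinarith

lemma tendsto_fst_domAtTop (d : ℕ) (b : ℝ → ℝ) :
    Tendsto (fun z : Fin (d + 1) → ℝ => z 0) (domAtTop d b) atTop :=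
  tendsto_comap.mono_left inf_le_left

lemma tendsto_succ_div_domAtTop (d : ℕ) {b : ℝ → ℝ} (k : ℝ)
    (hb : Tendsto (fun x => b x / x) atTop (𝓝 0)) (i : Fin d) :
    Tendsto (fun z => z i.succ / (z 0 + k)) (domAtTop d b) (𝓝 0) := by
  have hx := tendsto_fst_domAtTop d b
  have h1 : Tendsto (fun x : ℝ => (1 + k / x)⁻¹) atTop (𝓝 1) := by
    simpa using ((tendsto_const_nhds (x := k).div_atTop tendsto_id).const_add 1).inv₀ (by simp)
  have h2 := (hb.mul h1).comp hx
  rw [zero_mul] at h2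
  refine squeeze_zero_norm' ?_ h2
  rw [eventually_domAtTop]
  refine ⟨|k| + 1, fun z hz hzx => ?_⟩
  have h0 : 0 < z 0 := by linarith [abs_nonneg k]
  have hs : 0 < z 0 + k := by linarith [neg_abs_le k]
  have hy : |z i.succ| ≤ b (z 0) := by
    refine le_trans ?_ hz.2
    refine Real.abs_le_sqrt ?_
    exact Finset.single_le_sum (f := fun i : Fin d => z i.succ ^ 2)
      (fun i _ => sq_nonneg _) (Finset.mem_univ i)
  have h3 : b (z 0) / z 0 * (1 + k / z 0)⁻¹ = b (z 0) / (z 0 + k) := by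
    field_simp
  simp only [Function.comp, h3, norm_div, Real.norm_eq_abs, abs_of_pos hs]
  gcongr

lemma tendsto_quotient_domAtTop (d : ℕ) {b : ℝ → ℝ} (k c : ℝ)
    (hb : Tendsto (fun x => b x / x) atTop (𝓝 0)) :
    Tendsto (fun z => 1 + c * ynormSq d z / (2 * (z 0 + k) ^ 2)) (domAtTop d b) (𝓝 1) := by
  have h := ((tendsto_finsetSum Finset.univ fun (i : Fin d) _ =>
    (tendsto_succ_div_domAtTop d k hb i).pow 2).const_mul (c / 2)).const_add 1
  simp only [ne_eq, OfNat.ofNat_ne_zero, not_false_eq_true, zero_pow, Finset.sum_const_zero,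
    mul_zero, add_zero] at h
  refine h.congr fun z => ?_
  simp only [ynormSq, div_pow, ← Finset.sum_div]
  rw [div_mul_div_comm]

/-- Limit of the normalised Hessian of `fw` at infinity: a diagonal matrix. -/
def hessLimit (d : ℕ) (A B : ℝ) (i j : Fin (d + 1)) : ℝ :=
  if i = j then (if i = 0 then A else B) else 0

lemma sum_mul_hessLimit (d : ℕ) (M : Matrix (Fin (d + 1)) (Fin (d + 1)) ℝ) (A B : ℝ) :
    ∑ i, ∑ j, M i j * hessLimit d A B j i =
      A * M 0 0 + B * ((∑ i, M i i) - M 0 0) := by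
  have h : ∀ i, ∑ j, M i j * hessLimit d A B j i = M i i * if i = 0 then A else B := by
    intro i
    rw [Finset.sum_eq_single i]
    · simp [hessLimit]
    · intro j _ hj
      simp [hessLimit, hj]
    · simp
  simp only [h, Fin.sum_univ_succ, Fin.succ_ne_zero, if_true, if_false, ← Finset.sum_mul]
  ring

lemma tendsto_normalisedHess (d : ℕ) {b : ℝ → ℝ} (k c p a : ℝ)
    (hb : Tendsto (fun x => b x / x) atTop (𝓝 0)) (i j : Fin (d + 1)) :
    Tendsto (fun z => (z 0 + k) ^ 2 *
      (logGrad d k c p a i z * logGrad d k c p a j z + logHess d k c p a i j z))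
      (domAtTop d b) (𝓝 (hessLimit d ((p + 2 * a) ^ 2 - p - 2 * a) (a * c) i j)) := by
  set u : (Fin (d + 1) → ℝ) → ℝ := fun z => 1 + c * ynormSq d z / (2 * (z 0 + k) ^ 2)
  have hu1 : Tendsto u (domAtTop d b) (𝓝 1) := tendsto_quotient_domAtTop d k c hb
  have hui : Tendsto (fun z => (u z)⁻¹) (domAtTop d b) (𝓝 1) := by
    simpa using hu1.inv₀ one_ne_zero
  have hspos : ∀ᶠ z in domAtTop d b, 0 < z 0 + k :=
    (tendsto_fst_domAtTop d b).eventually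
      ((tendsto_atTop_add_const_right _ k tendsto_id).eventually_gt_atTop 0)
  have hupos : ∀ᶠ z in domAtTop d b, 0 < u z := hu1.eventually (lt_mem_nhds one_pos)
  have hg : ∀ i, Tendsto (fun z => shiftedQuadGrad d k c i z / (z 0 + k)) (domAtTop d b)
      (𝓝 (if i = 0 then 2 else 0)) := by
    intro i
    refine Fin.cases ?_ (fun i => ?_) i
    · refine (tendsto_const_nhds (x := (2 : ℝ))).congr' ?_
      filter_upwards [hspos] with z hz
      simp only [shiftedQuadGrad, if_true]
      field_simp
    · have h := (tendsto_succ_div_domAtTop d k hb i).const_mul c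
      simpa [shiftedQuadGrad, Fin.succ_ne_zero, mul_div_assoc] using h
  have hL : ∀ i, Tendsto (fun z => (if i = 0 then p else 0) +
      a * (shiftedQuadGrad d k c i z / (z 0 + k)) * (u z)⁻¹) (domAtTop d b)
      (𝓝 ((if i = 0 then p else 0) + a * (if i = 0 then 2 else 0) * 1)) :=
    fun i => (((hg i).const_mul a).mul hui).const_add _
  have hH : Tendsto (fun z => (if i = 0 ∧ j = 0 then -p else 0) +
      a * (if i = j then (if j = 0 then 2 else c) else 0) * (u z)⁻¹ -
      a * (shiftedQuadGrad d k c i z / (z 0 + k)) * (shiftedQuadGrad d k c j z / (z 0 + k)) *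
        (u z)⁻¹ ^ 2) (domAtTop d b)
      (𝓝 ((if i = 0 ∧ j = 0 then -p else 0) +
        a * (if i = j then (if j = 0 then 2 else c) else 0) * 1 -
        a * (if i = 0 then 2 else 0) * (if j = 0 then 2 else 0) * 1 ^ 2)) :=
    ((hui.const_mul _).const_add _).sub
      ((((hg i).const_mul a).mul (hg j)).mul (hui.pow 2))
  have hlim := ((hL i).mul (hL j)).add hH
  convert hlim.congr' ?_ using 2
  · by_cases hi : i = 0 <;> by_cases hj : j = 0 <;> by_cases hij : i = j <;>
      simp_all [hessLimit]
    ring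
  · filter_upwards [hspos, hupos] with z hz huz
    have hq : shiftedQuad d k c z = (z 0 + k) ^ 2 * u z := shiftedQuad_eq_mul d k c z hz.ne'
    have hif : (if i = 0 ∧ j = 0 then -p / (z 0 + k) ^ 2 else 0) =
        (if i = 0 ∧ j = 0 then -p else 0) / (z 0 + k) ^ 2 := by split_ifs <;> simp
    have hif' : ∀ i : Fin (d + 1), (if i = 0 then p / (z 0 + k) else 0) =
        (if i = 0 then p else 0) / (z 0 + k) := by intro i; split_ifs <;> simp
    simp only [logGrad, logHess, hq, hif, hif']
    field_simp

/-- **Asymptotics of the `Σ`-Laplacian of `f_{w,γ}`** (first claim of Lemma 2.1): under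
(D2) and (C2), there is a function `e` on `D` with `sup_{y : (x,y) ∈ D} |e(x,y)| → 0` as
`x → ∞` such that, for all `z = (x,y) ∈ D` with `x` sufficiently large,
`Δ_Σ f_{w,γ}(z) = γ f_{w,1}(z)^{γ−2} (σ₁²(γ−1) + σ₂²(1−w) + e(z))`. -/
theorem fw_lapSigma_asymptotics (d : ℕ) (hd : 0 < d) (b : ℝ → ℝ) (β σ1sq σ2sq : ℝ)
    (Sig : (Fin (d + 1) → ℝ) → Matrix (Fin (d + 1)) (Fin (d + 1)) ℝ)
    (hD2 : AssumpD2 b β) (hC2 : AssumpC2 d b Sig σ1sq σ2sq)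
    (γ w : ℝ) (hw : w ≠ 0) :
    ∃ e : (Fin (d + 1) → ℝ) → ℝ,
      (∀ ε : ℝ, 0 < ε → ∃ x₀ : ℝ, ∀ z ∈ Dom d b, x₀ ≤ z 0 → |e z| ≤ ε) ∧
      ∃ x₁ : ℝ, ∀ z ∈ Dom d b, x₁ ≤ z 0 →
        lapSigma d Sig (fw d b w γ) z
          = γ * (fw1 d b w z) ^ (γ - 2) * (σ1sq * (γ - 1) + σ2sq * (1 - w) + e z) := by
  obtain ⟨⟨-, -, -, hbC, -⟩, hb', -⟩ := hD2
  obtain ⟨⟨-, ⟨K, hK⟩, -⟩, -, -, hS1, hS2⟩ := hC2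
  have hb := tendsto_div_id_of_tendsto_deriv (hbC.differentiableOn (by norm_num)) hb'
  rcases eq_or_ne γ 0 with rfl | hγ
  · refine ⟨0, fun ε hε => ⟨0, fun z _ _ => by simpa using hε.le⟩, 0, fun z _ _ => ?_⟩
    have h : fw d b w 0 = fun _ => 1 := funext fun z => Real.rpow_zero _
    simp [lapSigma, hess, h]
  set k := kw b w
  set c := w * (1 - w) with hc
  set u : (Fin (d + 1) → ℝ) → ℝ := fun z => 1 + c * ynormSq d z / (2 * (z 0 + k) ^ 2)
  set G : Fin (d + 1) → Fin (d + 1) → (Fin (d + 1) → ℝ) → ℝ := fun i j z =>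
    (z 0 + k) ^ 2 * (logGrad d k c (γ - 2 * γ / w) (γ / w) i z *
      logGrad d k c (γ - 2 * γ / w) (γ / w) j z +
      logHess d k c (γ - 2 * γ / w) (γ / w) i j z) with hG
  have hGlim : ∀ i j, Tendsto (G i j) (domAtTop d b)
      (𝓝 (hessLimit d (γ * (γ - 1)) (γ * (1 - w)) i j)) := by
    intro i j
    convert tendsto_normalisedHess d k c (γ - 2 * γ / w) (γ / w) hb i j using 3
    · ring
    · rw [hc]
      field_simp
  have hu1 : Tendsto u (domAtTop d b) (𝓝 1) := tendsto_quotient_domAtTop d k c hb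
  have hspos : ∀ᶠ z in domAtTop d b, 0 < z 0 + k :=
    (tendsto_fst_domAtTop d b).eventually
      ((tendsto_atTop_add_const_right _ k tendsto_id).eventually_gt_atTop 0)
  have hupos : ∀ᶠ z in domAtTop d b, 0 < u z := hu1.eventually (lt_mem_nhds one_pos)
  have hlap : ∀ᶠ z in domAtTop d b, lapSigma d Sig (fw d b w γ) z =
      fw1 d b w z ^ (γ - 2) * (u z ^ (2 / w) * ∑ i, ∑ j, Sig z i j * G j i z) := by
    filter_upwards [hspos, hupos] with z hz huz
    have hq : 0 < shiftedQuad d k c z := by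
      rw [shiftedQuad_eq_mul d k c z hz.ne']
      positivity
    have hf1 : fw1 d b w z = (z 0 + k) * u z ^ (1 / w) := rfl
    have hf1pos : 0 < fw1 d b w z := by rw [hf1]; positivity
    have hf : fw d b w γ z = fw1 d b w z ^ (γ - 2) * (u z ^ (2 / w) * (z 0 + k) ^ 2) := by
      have hsq : u z ^ (2 / w) * (z 0 + k) ^ 2 = fw1 d b w z ^ (2 : ℝ) := by
        rw [hf1, Real.mul_rpow hz.le (by positivity), ← Real.rpow_mul huz.le, Real.rpow_two]
        ring_nf
      rw [hsq, ← Real.rpow_add hf1pos, sub_add_cancel, fw]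
    simp only [lapSigma, hess_fw d b w γ _ _ z hz hq, hf, hG, Finset.mul_sum]
    refine Finset.sum_congr rfl fun i _ => Finset.sum_congr rfl fun j _ => ?_
    ring
  have hSum : Tendsto (fun z => ∑ i, ∑ j, Sig z i j * G j i z) (domAtTop d b)
      (𝓝 (γ * (σ1sq * (γ - 1) + σ2sq * (1 - w)))) := by
    have h0 : Tendsto (fun z => ∑ i, ∑ j, Sig z i j *
        (G j i z - hessLimit d (γ * (γ - 1)) (γ * (1 - w)) j i)) (domAtTop d b) (𝓝 0) := by
      rw [show (0 : ℝ) = ∑ i : Fin (d + 1), ∑ j : Fin (d + 1), 0 by simp]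
      refine tendsto_finsetSum _ fun i _ => tendsto_finsetSum _ fun j _ => ?_
      have hlim : Tendsto (fun z => G j i z - hessLimit d (γ * (γ - 1)) (γ * (1 - w)) j i)
          (domAtTop d b) (𝓝 0) := by
        simpa using (hGlim j i).sub_const (hessLimit d (γ * (γ - 1)) (γ * (1 - w)) j i)
      refine bdd_le_mul_tendsto_zero' K ?_ hlim
      exact (eventually_domAtTop d b).mpr ⟨0, fun z hz _ => hK z hz i j⟩
    have h1 := (((tendsto_domAtTop d b).mpr hS1).const_mul (γ * (γ - 1))).add
      (((tendsto_domAtTop d b).mpr hS2).const_mul (γ * (1 - w)))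
    convert h0.add h1 using 2 with z
    · rw [← sum_mul_hessLimit, ← Finset.sum_add_distrib]
      simp_rw [← Finset.sum_add_distrib]
      refine Finset.sum_congr rfl fun i _ => Finset.sum_congr rfl fun j _ => ?_
      ring
    · ring
  have hup : Tendsto (fun z => u z ^ (2 / w)) (domAtTop d b) (𝓝 1) := by
    simpa using hu1.rpow_const (p := 2 / w) (Or.inl one_ne_zero)
  refine ⟨fun z => u z ^ (2 / w) * (∑ i, ∑ j, Sig z i j * G j i z) / γ -
    (σ1sq * (γ - 1) + σ2sq * (1 - w)), ?_, ?_⟩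
  · have h := ((hup.mul hSum).div_const γ).sub_const (σ1sq * (γ - 1) + σ2sq * (1 - w))
    rw [one_mul, mul_div_cancel_left₀ _ hγ, sub_self] at h
    simpa using (tendsto_domAtTop d b).mp h
  · obtain ⟨x₁, hx₁⟩ := (eventually_domAtTop d b).mp hlap
    refine ⟨x₁, fun z hz hzx => ?_⟩
    rw [hx₁ z hz hzx]
    field_simp
    ring

end
end

section
/- Gradient bound for the Lyapunov function f_{w,γ} (second claim of Lemma 2.1 of the paper). Assume (D2) and fix γ ∈ ℝ and w ∈ ℝ∖{0}. Then there exists a constant C > 0 such that ‖∇f_{w,γ}(z)‖² ≤ C·(x + k_w)^{2(γ−1)} for all z = (x,y) ∈ D. -/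
open Real Filter Set Topology

noncomputable section

/-- Under (D2), `c * b x - x` is bounded above on `[0, ∞)`. -/
lemma AssumpD2.bddAbove_image {b : ℝ → ℝ} {β : ℝ} (h : AssumpD2 b β) {c : ℝ} (hc : 0 ≤ c) :
    BddAbove ((fun x => c * b x - x) '' Ici (0 : ℝ)) := by
  obtain ⟨⟨hcont, -, -, hC2, -, -⟩, hb', -⟩ := h
  have hev : ∀ᶠ x in atTop, deriv b x < 1 / (c + 1) := hb'.eventually_lt_const (by positivity)
  obtain ⟨N, hN⟩ := ((hev.and (eventually_gt_atTop 0)).exists_forall_of_atTop)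
  have hN0 : 0 < N := (hN N le_rfl).2
  have hdiff : ∀ x, 0 < x → HasDerivAt (fun x => c * b x - x) (c * deriv b x - 1) x := by
    intro x hx
    have : DifferentiableAt ℝ b x :=
      (hC2.differentiableOn (by norm_num)).differentiableAt (Ioi_mem_nhds hx)
    exact (this.hasDerivAt.const_mul c).sub (hasDerivAt_id x)
  have hcontg : ContinuousOn (fun x => c * b x - x) (Ici 0) :=
    (hcont.const_smul c).sub continuousOn_id
  have hanti : AntitoneOn (fun x => c * b x - x) (Ici N) := by
    refine antitoneOn_of_deriv_nonpos (convex_Ici N)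
      (hcontg.mono (Ici_subset_Ici.2 hN0.le)) ?_ ?_
    · intro x hx
      rw [interior_Ici] at hx
      exact (hdiff x (hN0.trans hx)).differentiableAt.differentiableWithinAt
    · intro x hx
      rw [interior_Ici] at hx
      rw [(hdiff x (hN0.trans hx)).deriv]
      have h1 := (hN x (le_of_lt hx)).1
      rw [lt_div_iff₀ (by positivity)] at h1
      rcases le_total 0 (deriv b x) with h0 | h0 <;> nlinarith
  obtain ⟨M, hM⟩ := (isCompact_Icc (a := (0 : ℝ)) (b := N)).bddAbove_image
    (hcontg.mono Icc_subset_Ici_self)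
  refine ⟨M, ?_⟩
  rintro _ ⟨x, hx, rfl⟩
  rcases le_total x N with hxN | hxN
  · exact hM ⟨x, ⟨hx, hxN⟩, rfl⟩
  · exact (hanti (mem_Ici.2 le_rfl) hxN hxN).trans (hM ⟨N, ⟨hN0.le, le_rfl⟩, rfl⟩)

lemma AssumpD2.le_add_kw {b : ℝ → ℝ} {β : ℝ} (h : AssumpD2 b β) (w : ℝ) {x : ℝ} (hx : 0 ≤ x) :
    1 + √|w * (1 - w)| * b x ≤ x + kw b w := by
  have := le_csSup (h.bddAbove_image (Real.sqrt_nonneg |w * (1 - w)|)) ⟨x, hx, rfl⟩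
  unfold kw
  dsimp only at this
  linarith

lemma AssumpD2.nonneg {b : ℝ → ℝ} {β : ℝ} (h : AssumpD2 b β) {x : ℝ} (hx : 0 ≤ x) : 0 ≤ b x := by
  rcases hx.eq_or_lt with rfl | hx
  · exact h.1.2.1.ge
  · exact (h.1.2.2.1 x hx).le

lemma ynormSq_nonneg (d : ℕ) (z : Fin (d + 1) → ℝ) : 0 ≤ ynormSq d z :=
  Finset.sum_nonneg fun _ _ => sq_nonneg _

/-- On the domain, `|w (1 - w)| ‖y‖² ≤ (x + k_w)²`. -/
lemma AssumpD2.abs_mul_ynormSq_le {b : ℝ → ℝ} {β : ℝ} (h : AssumpD2 b β) (w : ℝ) {d : ℕ}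
    {z : Fin (d + 1) → ℝ} (hz : z ∈ Dom d b) :
    |w * (1 - w)| * ynormSq d z ≤ (z 0 + kw b w) ^ 2 := by
  have h1 := h.le_add_kw w hz.1
  have h2 : √|w * (1 - w)| * ynorm d z ≤ z 0 + kw b w := by
    have := mul_le_mul_of_nonneg_left hz.2 (Real.sqrt_nonneg |w * (1 - w)|)
    linarith
  calc |w * (1 - w)| * ynormSq d z = (√|w * (1 - w)| * ynorm d z) ^ 2 := by
        rw [mul_pow, Real.sq_sqrt (abs_nonneg _), ynorm, Real.sq_sqrt (ynormSq_nonneg d z)]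
    _ ≤ _ := pow_le_pow_left₀ (mul_nonneg (Real.sqrt_nonneg _) (Real.sqrt_nonneg _)) h2 2

lemma rpow_le_two_rpow_abs {t : ℝ} (h1 : 1 / 2 ≤ t) (h2 : t ≤ 2) (p : ℝ) :
    t ^ p ≤ 2 ^ |p| := by
  have ht : 0 < t := by linarith
  have hlog : |Real.log t| ≤ Real.log 2 := by
    rw [abs_le]
    refine ⟨?_, Real.log_le_log ht h2⟩
    rw [← Real.log_inv]
    exact Real.log_le_log (by norm_num) (by linarith)
  rw [Real.rpow_def_of_pos ht, Real.rpow_def_of_pos two_pos]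
  refine Real.exp_le_exp.2 ?_
  calc Real.log t * p ≤ |Real.log t * p| := le_abs_self _
    _ = |Real.log t| * |p| := abs_mul _ _
    _ ≤ _ := by gcongr

/-- The total derivative of `‖y‖²`. -/
lemma hasFDerivAt_ynormSq (d : ℕ) (z : Fin (d + 1) → ℝ) :
    HasFDerivAt (ynormSq d)
      (∑ i : Fin d, (2 * z i.succ) •
        (ContinuousLinearMap.proj i.succ : (Fin (d + 1) → ℝ) →L[ℝ] ℝ)) z := by
  have : ynormSq d = fun z => ∑ i : Fin d, (z i.succ) ^ 2 := rfl
  rw [this]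
  refine HasFDerivAt.fun_sum fun i _ => ?_
  simpa using (hasFDerivAt_apply (𝕜 := ℝ) (F' := fun _ : Fin (d + 1) => ℝ) i.succ z).pow 2

/-- The derivative of `x^γ (1 + a s / (2 x²))^p` along a differentiable pair `(x, s)`. -/
lemma HasFDerivAt.rpow_mul_one_add_rpow {E : Type*} [NormedAddCommGroup E] [NormedSpace ℝ E]
    {X S : E → ℝ} {X' S' : E →L[ℝ] ℝ} {z : E} (hX : HasFDerivAt X X' z) (hS : HasFDerivAt S S' z)
    {a : ℝ} (hX0 : 0 < X z) (hT : 0 < 1 + a * S z / (2 * X z ^ 2)) (γ p : ℝ) (v : E) :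
    fderiv ℝ (fun z => X z ^ γ * (1 + a * S z / (2 * X z ^ 2)) ^ p) z v =
      X z ^ (γ - 1) * ((γ * (1 + a * S z / (2 * X z ^ 2)) ^ p
        - 2 * p * (a * S z / (2 * X z ^ 2)) * (1 + a * S z / (2 * X z ^ 2)) ^ (p - 1)) * X' v
        + p * (1 + a * S z / (2 * X z ^ 2)) ^ (p - 1) * (a * S' v / (2 * X z))) := by
  set x := X z with hx
  set u := a * S z / (2 * x ^ 2) with hu
  have h1 := hX.rpow_const (p := γ) (Or.inl hX0.ne')
  have hinv := (hasDerivAt_inv (x := 2 * X z ^ 2) (by positivity)).comp_hasFDerivAt z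
    ((hX.pow 2).const_mul 2)
  have hT' : HasFDerivAt (fun z => 1 + a * S z / (2 * X z ^ 2)) _ z :=
    ((hS.const_mul a).mul hinv).const_add 1
  have h2 := hT'.rpow_const (p := p) (Or.inl hT.ne')
  rw [HasFDerivAt.fderiv (h1.fun_mul h2)]
  have hxγ : x ^ γ = x ^ (γ - 1) * x := by
    rw [← Real.rpow_add_one hX0.ne', sub_add_cancel]
  simp only [add_apply, smul_apply, smul_eq_mul,
    Function.comp_apply, ← hx, ← hu, hxγ, nsmul_eq_mul, Nat.cast_ofNat]
  have hS2 : a * S z = u * (2 * x ^ 2) := by rw [hu]; field_simp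
  rw [hS2]
  field_simp
  ring

lemma sq_two_mul_ynormSq_partial_le (d : ℕ) (z : Fin (d + 1) → ℝ) (i : Fin (d + 1)) :
    ((∑ j : Fin d, (2 * z j.succ) • (ContinuousLinearMap.proj j.succ :
      (Fin (d + 1) → ℝ) →L[ℝ] ℝ)) (Pi.single i 1)) ^ 2 ≤ 4 * ynormSq d z := by
  have := ynormSq_nonneg d z
  induction i using Fin.cases with
  | zero => simpa [sum_apply] using this
  | succ i =>
    have h : (∑ j : Fin d, (2 * z j.succ) • (ContinuousLinearMap.proj j.succ :
        (Fin (d + 1) → ℝ) →L[ℝ] ℝ)) (Pi.single i.succ 1) = 2 * z i.succ := by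
      simp [Pi.single_apply]
    rw [h, mul_pow]
    have := Finset.single_le_sum (f := fun j : Fin d => z j.succ ^ 2)
      (fun j _ => sq_nonneg _) (Finset.mem_univ i)
    unfold ynormSq
    linarith

lemma ynormSq_continuous (d : ℕ) : Continuous (ynormSq d) :=
  continuous_iff_continuousAt.2 fun z => (hasFDerivAt_ynormSq d z).continuousAt

/-- Near points with `x + k_w > 0` where its base is positive, `f_{w,γ}` splits as a product of
powers. -/
lemma fw_eventuallyEq {d : ℕ} {b : ℝ → ℝ} (γ w : ℝ) {z : Fin (d + 1) → ℝ}
    (hX : 0 < z 0 + kw b w)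
    (hT : 0 < 1 + w * (1 - w) * ynormSq d z / (2 * (z 0 + kw b w) ^ 2)) :
    fw d b w γ =ᶠ[𝓝 z] fun z => (z 0 + kw b w) ^ γ *
      (1 + w * (1 - w) * ynormSq d z / (2 * (z 0 + kw b w) ^ 2)) ^ (γ / w) := by
  have hcX : ContinuousAt (fun z : Fin (d + 1) → ℝ => z 0 + kw b w) z :=
    (continuous_apply 0).continuousAt.add continuousAt_const
  have hcT : ContinuousAt (fun z : Fin (d + 1) → ℝ =>
      1 + w * (1 - w) * ynormSq d z / (2 * (z 0 + kw b w) ^ 2)) z := by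
    refine continuousAt_const.add (ContinuousAt.div ?_ ?_ (by positivity))
    · exact continuousAt_const.mul (ynormSq_continuous d).continuousAt
    · exact continuousAt_const.mul (hcX.pow 2)
  filter_upwards [hcX.eventually_const_lt hX, hcT.eventually_const_lt hT] with y hy1 hy2
  rw [fw, fw1, Real.mul_rpow hy1.le (Real.rpow_nonneg hy2.le _), ← Real.rpow_mul hy2.le,
    one_div_mul_eq_div]

/-- **Gradient bound for the Lyapunov function `f_{w,γ}`** (second claim of Lemma 2.1):
under (D2), there is `C > 0` with `‖∇f_{w,γ}(z)‖² ≤ C (x+k_w)^{2(γ−1)}` on `D`. -/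
theorem fw_gradient_bound (d : ℕ) (hd : 0 < d) (b : ℝ → ℝ) (β : ℝ)
    (hD2 : AssumpD2 b β) (γ w : ℝ) (hw : w ≠ 0) :
    ∃ C : ℝ, 0 < C ∧ ∀ z ∈ Dom d b,
      ∑ i, (pderiv d (fw d b w γ) i z) ^ 2 ≤ C * (z 0 + kw b w) ^ (2 * (γ - 1)) := by
  set p := γ / w with hp
  set a := w * (1 - w) with ha
  set M : ℝ := |γ| * 2 ^ |p| + |p| * 2 ^ |p - 1| + |p| * 2 ^ |p - 1| * √|a| with hM
  have hM0 : 0 ≤ M := by positivity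
  refine ⟨(d + 1 : ℝ) * M ^ 2 + 1, by positivity, fun z hz => ?_⟩
  set X := z 0 + kw b w with hXdef
  have hX : 0 < X := by
    have h1 := hD2.le_add_kw w hz.1
    have h2 := mul_nonneg (Real.sqrt_nonneg |w * (1 - w)|) (hD2.nonneg hz.1)
    linarith
  have hQ0 := ynormSq_nonneg d z
  have hQ : |a| * ynormSq d z ≤ X ^ 2 := hD2.abs_mul_ynormSq_le w hz
  set u := a * ynormSq d z / (2 * X ^ 2) with hu
  have hu' : |u| ≤ 1 / 2 := by
    rw [hu, abs_div, abs_mul, abs_of_nonneg hQ0, abs_of_pos (by positivity : 0 < 2 * X ^ 2),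
      div_le_iff₀ (by positivity)]
    linarith
  obtain ⟨hu1, hu2⟩ := abs_le.1 hu'
  have hT : 0 < 1 + u := by linarith
  have hpow (q : ℝ) : |(1 + u) ^ q| ≤ 2 ^ |q| := by
    rw [abs_of_pos (Real.rpow_pos_of_pos hT q)]
    exact rpow_le_two_rpow_abs (by linarith) (by linarith) q
  have key (i : Fin (d + 1)) :
      pderiv d (fw d b w γ) i z ^ 2 ≤ M ^ 2 * X ^ (2 * (γ - 1)) := by
    have hproj : HasFDerivAt (fun z : Fin (d + 1) → ℝ => z 0 + kw b w)
        (ContinuousLinearMap.proj 0 : (Fin (d + 1) → ℝ) →L[ℝ] ℝ) z :=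
      (hasFDerivAt_apply (𝕜 := ℝ) (F' := fun _ : Fin (d + 1) => ℝ) 0 z).add_const _
    rw [pderiv, (fw_eventuallyEq γ w hX hT).fderiv_eq,
      hproj.rpow_mul_one_add_rpow (hasFDerivAt_ynormSq d z) hX hT γ (γ / w)]
    set D := (∑ j : Fin d, (2 * z j.succ) • (ContinuousLinearMap.proj j.succ :
      (Fin (d + 1) → ℝ) →L[ℝ] ℝ)) (Pi.single i 1) with hD
    set e := (ContinuousLinearMap.proj 0 : (Fin (d + 1) → ℝ) →L[ℝ] ℝ) (Pi.single i 1) with he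
    have hDsq : D ^ 2 ≤ 4 * ynormSq d z := sq_two_mul_ynormSq_partial_le d z i
    have he1 : |e| ≤ 1 := by
      rw [he, ContinuousLinearMap.proj_apply, Pi.single_apply]
      split_ifs <;> simp
    have hDX : |a * D / (2 * X)| ≤ √|a| := by
      apply Real.le_sqrt_of_sq_le
      rw [sq_abs, div_pow, mul_pow, ← sq_abs a, div_le_iff₀ (by positivity)]
      have h1 := mul_le_mul_of_nonneg_left hDsq (sq_nonneg |a|)
      have h2 := mul_le_mul_of_nonneg_left hQ (abs_nonneg a)
      linarith
    rw [← hXdef, ← hu, ← hp, mul_pow, ← Real.rpow_mul_natCast hX.le, mul_comm]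
    have hexp : (γ - 1) * ((2 : ℕ) : ℝ) = 2 * (γ - 1) := by push_cast; ring
    rw [hexp]
    refine mul_le_mul_of_nonneg_right ?_ (Real.rpow_nonneg hX.le _)
    rw [← sq_abs]
    refine pow_le_pow_left₀ (abs_nonneg _) ?_ 2
    have hsum : |γ * (1 + u) ^ p - 2 * p * u * (1 + u) ^ (p - 1)|
        ≤ |γ| * 2 ^ |p| + |p| * 2 ^ |p - 1| := by
      refine (abs_sub _ _).trans (add_le_add ?_ ?_)
      · rw [abs_mul]
        exact mul_le_mul_of_nonneg_left (hpow p) (abs_nonneg _)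
      · rw [abs_mul]
        refine mul_le_mul ?_ (hpow _) (abs_nonneg _) (abs_nonneg _)
        rw [abs_mul, abs_mul, abs_two]
        nlinarith [abs_nonneg p]
    refine (abs_add_le _ _).trans (add_le_add ?_ ?_)
    · rw [abs_mul]
      exact (mul_le_mul hsum he1 (abs_nonneg _) (by positivity)).trans_eq (mul_one _)
    · rw [abs_mul, abs_mul]
      exact mul_le_mul (mul_le_mul_of_nonneg_left (hpow _) (abs_nonneg _)) hDX (abs_nonneg _)
        (by positivity)
  calc ∑ i, pderiv d (fw d b w γ) i z ^ 2
      ≤ ∑ _i : Fin (d + 1), M ^ 2 * X ^ (2 * (γ - 1)) := Finset.sum_le_sum fun i _ => key i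
    _ = (d + 1 : ℝ) * M ^ 2 * X ^ (2 * (γ - 1)) := by simp; ring
    _ ≤ _ := by
      have := Real.rpow_nonneg hX.le (2 * (γ - 1))
      nlinarith

end
end

section
/- Sign of the boundary pairing of the Lyapunov function f_{w,γ} with the reflection field (third claim of Lemma 2.1 of the paper). Assume (D2) and (V2), and fix γ ∈ ℝ and w ∈ ℝ∖{0}. If γ·(s₀β/c₀ − 1 + w) < 0 (respectively, > 0), then there exists x₀ > 0 such that for all z = (x,y) ∈ ∂D with x ≥ x₀ one has ⟨∇f_{w,γ}(z), φ(z)⟩ < 0 (respectively, > 0). -/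
open Real Filter Set Topology

noncomputable section

/-- The inward-pointing unit normal vector
`n(x, b(x)ŷ) = (1 + b'(x)²)^{-1/2} (b'(x) eₓ − e_ŷ)` at a boundary point. -/
def nvec (d : ℕ) (b : ℝ → ℝ) (z : Fin (d + 1) → ℝ) : Fin (d + 1) → ℝ :=
  fun i => (Real.sqrt (1 + (deriv b (z 0)) ^ 2))⁻¹ *
    (if i = 0 then deriv b (z 0) else -(z i) / ynorm d z)

/-- The projection `⟨φ(z), −e_ŷ⟩` of the vector field `φ` at a boundary point. -/
def phiYproj (d : ℕ) (φ : (Fin (d + 1) → ℝ) → Fin (d + 1) → ℝ)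
    (z : Fin (d + 1) → ℝ) : ℝ :=
  -(∑ j : Fin d, φ z j.succ * z j.succ) / ynorm d z

/-- Assumption (V1) on the reflection vector field `φ`: a bounded `C²` vector field on
`∂D` with uniformly positive inner product with the inward normal. -/
def AssumpV1 (d : ℕ) (b : ℝ → ℝ) (φ : (Fin (d + 1) → ℝ) → Fin (d + 1) → ℝ) : Prop :=
  ContDiffOn ℝ 2 φ (Bdry d b) ∧
    (∃ K : ℝ, ∀ z ∈ Bdry d b, Real.sqrt (∑ i, (φ z i) ^ 2) ≤ K) ∧
    (∃ c : ℝ, 0 < c ∧ ∀ z ∈ Bdry d b, 0 < z 0 → c ≤ ∑ i, φ z i * nvec d b z i)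

/-- Assumption (V2): (V1) together with `⟨φ(z), e_x⟩ = s₀ b'(x)(1 + ε₁(z))` and
`⟨φ(z), −e_ŷ⟩ = c₀ (1 + ε₂(z))` with `sup_{y : (x,y) ∈ ∂D} |ε_i(x,y)| → 0` as `x → ∞`. -/
def AssumpV2 (d : ℕ) (b : ℝ → ℝ) (φ : (Fin (d + 1) → ℝ) → Fin (d + 1) → ℝ)
    (s₀ c₀ : ℝ) : Prop :=
  AssumpV1 d b φ ∧ 0 < s₀ ∧ 0 < c₀ ∧
    (∀ ε : ℝ, 0 < ε → ∃ x₀ : ℝ, ∀ z ∈ Bdry d b, x₀ ≤ z 0 →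
      |φ z 0 - s₀ * deriv b (z 0)| ≤ ε * |s₀ * deriv b (z 0)|) ∧
    (∀ ε : ℝ, 0 < ε → ∃ x₀ : ℝ, ∀ z ∈ Bdry d b, x₀ ≤ z 0 →
      |phiYproj d φ z - c₀| ≤ ε * c₀)

lemma tendsto_div_atTop_of_tendsto_deriv_zero {b : ℝ → ℝ} (hd : ∀ᶠ x in atTop, DifferentiableAt ℝ b x)
    (h : Tendsto (deriv b) atTop (𝓝 0)) : Tendsto (fun x => b x / x) atTop (𝓝 0) := by
  rw [Metric.tendsto_nhds]
  intro ε hε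
  have h1 := (Metric.tendsto_nhds.1 h) (ε / 2) (by positivity)
  obtain ⟨M, hM⟩ := eventually_atTop.1 (h1.and hd)
  set N := max M 1
  have hlip : ∀ x, N ≤ x → |b x - b N| ≤ ε / 2 * (x - N) := by
    intro x hx
    have := (convex_Ici N).norm_image_sub_le_of_norm_deriv_le (f := b) (C := ε / 2)
      (fun y hy => (hM y (le_trans (le_max_left _ _) hy)).2)
      (fun y hy => by
        have := (hM y (le_trans (le_max_left _ _) hy)).1
        rw [dist_zero_right] at this
        exact this.le) (self_mem_Ici) (show x ∈ Ici N from hx)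
    rwa [Real.norm_eq_abs, Real.norm_eq_abs, abs_of_nonneg (sub_nonneg.2 hx)] at this
  filter_upwards [eventually_ge_atTop N, eventually_gt_atTop (2 * |b N| / ε)] with x hx hx2
  have hN : 1 ≤ N := le_max_right _ _
  have hx0 : 0 < x := by linarith
  rw [dist_zero_right, Real.norm_eq_abs, abs_div, abs_of_pos hx0, div_lt_iff₀ hx0]
  rw [div_lt_iff₀ hε] at hx2
  have h3 := hlip x hx
  have h4 : |b x| ≤ |b x - b N| + |b N| := by
    simpa using abs_add_le (b x - b N) (b N)
  nlinarith

lemma sum_pderiv_mul {d : ℕ} (f : (Fin (d + 1) → ℝ) → ℝ) (z v : Fin (d + 1) → ℝ) :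
    ∑ i, pderiv d f i z * v i = fderiv ℝ f z v := by
  conv_rhs => rw [← ContinuousLinearMap.coe_coe, LinearMap.pi_apply_eq_sum_univ]
  refine Finset.sum_congr rfl fun i _ => ?_
  rw [pderiv, smul_eq_mul, mul_comm, ContinuousLinearMap.coe_coe]
  congr 2
  ext j
  simp [Pi.single_apply, eq_comm]

lemma fderiv_fw_apply {d : ℕ} {b : ℝ → ℝ} {w γ : ℝ} (hw : w ≠ 0) (z v : Fin (d + 1) → ℝ)
    {X u : ℝ} (hXz : z 0 + kw b w = X)
    (huz : 1 + w * (1 - w) * ynormSq d z / (2 * X ^ 2) = u) (hX : 0 < X) (hu : 0 < u) :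
    fderiv ℝ (fw d b w γ) z v =
      γ * (X * u ^ (1 / w)) ^ (γ - 1) * u ^ (1 / w - 1) *
        ((u - (1 - w) * ynormSq d z / X ^ 2) * v 0 +
          (1 - w) / X * ∑ j : Fin d, v j.succ * z j.succ) := by
  subst hXz
  subst huz
  have hd : DifferentiableAt ℝ (fw d b w γ) z := by
    have hq : DifferentiableAt ℝ (fun z : Fin (d + 1) → ℝ => ynormSq d z) z := by
      unfold ynormSq
      fun_prop
    have hbase : DifferentiableAt ℝ (fun z : Fin (d + 1) → ℝ =>
        1 + w * (1 - w) * ynormSq d z / (2 * (z 0 + kw b w) ^ 2)) z := by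
      fun_prop (disch := positivity)
    have h1 : DifferentiableAt ℝ (fun z : Fin (d + 1) → ℝ => fw1 d b w z) z :=
      DifferentiableAt.mul (by fun_prop) (hbase.rpow_const (Or.inl hu.ne'))
    exact h1.rpow_const (Or.inl (by unfold fw1; positivity))
  have hline : HasDerivAt (fun t : ℝ => z + t • v) v 0 := by
    simpa using ((hasDerivAt_id (0 : ℝ)).smul_const v).const_add z
  have hF : HasDerivAt (fun t : ℝ => fw d b w γ (z + t • v)) (fderiv ℝ (fw d b w γ) z v) 0 := by
    have hd' : HasFDerivAt (fw d b w γ) (fderiv ℝ (fw d b w γ) z) (z + (0 : ℝ) • v) := by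
      simpa using hd.hasFDerivAt
    exact hd'.comp_hasDerivAt (0 : ℝ) hline
  have hcoord : ∀ i, HasDerivAt (fun t : ℝ => (z + t • v) i) (v i) 0 :=
    hasDerivAt_pi.1 hline
  have hXd := (hcoord 0).add_const (kw b w)
  have hqd : HasDerivAt (fun t : ℝ => ynormSq d (z + t • v))
      (2 * ∑ j : Fin d, v j.succ * z j.succ) 0 := by
    unfold ynormSq
    refine (HasDerivAt.fun_sum (u := Finset.univ)
      fun (j : Fin d) _ => (hcoord j.succ).fun_pow 2).congr_deriv ?_
    rw [Finset.mul_sum]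
    refine Finset.sum_congr rfl fun j _ => ?_
    simp
    ring
  have hud := ((hqd.const_mul (w * (1 - w))).fun_div ((hXd.fun_pow 2).const_mul 2)
    (by simp only [zero_smul, add_zero]; positivity)).const_add 1
  have h1d := hXd.fun_mul (hud.rpow_const (p := 1 / w)
    (Or.inl (by simp only [zero_smul, add_zero]; exact hu.ne')))
  have hγd := h1d.rpow_const (p := γ)
    (Or.inl (by simp only [zero_smul, add_zero]; positivity))
  have := hF.unique hγd
  rw [this]
  simp only [zero_smul, add_zero]
  set X := z 0 + kw b w
  set q := ynormSq d z
  set S := ∑ j : Fin d, v j.succ * z j.succ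
  set u := 1 + w * (1 - w) * q / (2 * X ^ 2) with hu_def
  have hpow : u ^ (1 / w) = u ^ (1 / w - 1) * u := by
    rw [← Real.rpow_add_one hu.ne']
    congr 1
    ring
  generalize (X * u ^ (1 / w)) ^ (γ - 1) = R
  rw [hpow]
  generalize u ^ (1 / w - 1) = T
  rw [hu_def]
  field_simp
  ring

/-- The trace on `∂D` of neighbourhoods of infinity in the `x`-direction. -/
def bdryAtTop (d : ℕ) (b : ℝ → ℝ) : Filter (Fin (d + 1) → ℝ) :=
  comap (fun z => z 0) atTop ⊓ 𝓟 (Bdry d b)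

lemma eventually_bdryAtTop {d : ℕ} {b : ℝ → ℝ} {p : (Fin (d + 1) → ℝ) → Prop} :
    (∀ᶠ z in bdryAtTop d b, p z) ↔ ∃ x₀ : ℝ, ∀ z ∈ Bdry d b, x₀ ≤ z 0 → p z := by
  rw [bdryAtTop, eventually_inf_principal, (atTop_basis.comap _).eventually_iff]
  simp only [true_and, mem_preimage, mem_Ici]
  exact exists_congr fun _ => forall_congr' fun _ => forall_comm

lemma tendsto_apply_zero_bdryAtTop (d : ℕ) (b : ℝ → ℝ) :
    Tendsto (fun z => z 0) (bdryAtTop d b) atTop :=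
  tendsto_comap.mono_left inf_le_left

/-- On `∂D`, the pairing of `∇f_{w,γ}` with the reflection field equals `γ` times a positive
factor times a function converging to `s₀β - (1-w)c₀`. -/
lemma exists_pairing_eq_mul {d : ℕ} {b : ℝ → ℝ} {β s₀ c₀ : ℝ}
    {φ : (Fin (d + 1) → ℝ) → Fin (d + 1) → ℝ}
    (hD2 : AssumpD2 b β) (hV2 : AssumpV2 d b φ s₀ c₀) (γ : ℝ) {w : ℝ} (hw : w ≠ 0) :
    ∃ g p : (Fin (d + 1) → ℝ) → ℝ,
      Tendsto g (bdryAtTop d b) (𝓝 (s₀ * β - (1 - w) * c₀)) ∧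
      ∀ᶠ z in bdryAtTop d b, 0 < p z ∧
        ∑ i, pderiv d (fw d b w γ) i z * φ z i = p z * (γ * g z) := by
  obtain ⟨⟨-, -, hbpos, hbC, -, -⟩, hb', -, -, hβ⟩ := hD2
  obtain ⟨-, -, hc₀, hφ0, hφy⟩ := hV2
  set l := bdryAtTop d b
  set k := kw b w
  have hx : Tendsto (fun z : Fin (d + 1) → ℝ => z 0) l atTop := tendsto_apply_zero_bdryAtTop d b
  have hbdry : ∀ᶠ z in l, z ∈ Bdry d b :=
    (eventually_principal.2 fun _ h => h).filter_mono inf_le_right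
  have hX : Tendsto (fun x : ℝ => x + k) atTop atTop := tendsto_atTop_add_const_right _ _ tendsto_id
  have hXx : Tendsto (fun x : ℝ => (x + k) / x) atTop (𝓝 1) := by
    have h : Tendsto (fun x : ℝ => 1 + k / x) atTop (𝓝 (1 + 0)) :=
      tendsto_const_nhds.add (tendsto_const_nhds.div_atTop tendsto_id)
    rw [add_zero] at h
    refine h.congr' ?_
    filter_upwards [eventually_gt_atTop 0] with x hx
    field_simp
  have hbx : Tendsto (fun x => b x / x) atTop (𝓝 0) := by
    refine tendsto_div_atTop_of_tendsto_deriv_zero ?_ hb'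
    filter_upwards [eventually_gt_atTop 0] with x hx
    exact (hbC.differentiableOn (by norm_num)).differentiableAt (Ioi_mem_nhds hx)
  have hbX : Tendsto (fun x => b x / (x + k)) atTop (𝓝 0) := by
    have h := hbx.div hXx one_ne_zero
    rw [zero_div] at h
    refine h.congr' ?_
    filter_upwards [eventually_gt_atTop 0] with x hx
    simp only [Pi.div_apply]
    field_simp
  have hβX : Tendsto (fun x => s₀ * deriv b x * ((x + k) / b x)) atTop (𝓝 (s₀ * β)) := by
    have h := (hβ.mul hXx).const_mul s₀
    rw [mul_one] at h
    refine h.congr' ?_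
    filter_upwards [eventually_gt_atTop 0] with x hx
    field_simp
  have hu : Tendsto (fun x => 1 + w * (1 - w) * b x ^ 2 / (2 * (x + k) ^ 2)) atTop (𝓝 1) := by
    have h := ((hbX.pow 2).const_mul (w * (1 - w) / 2)).const_add 1
    norm_num at h
    refine h.congr fun x => ?_
    rw [div_pow, div_mul_div_comm]
  have hφ0' : Asymptotics.IsEquivalent l (fun z => φ z 0) (fun z => s₀ * deriv b (z 0)) := by
    refine Asymptotics.isLittleO_iff.2 fun ε hε => ?_
    exact eventually_bdryAtTop.2 (hφ0 ε hε)
  have hφX : Tendsto (fun z => φ z 0 * ((z 0 + k) / b (z 0))) l (𝓝 (s₀ * β)) :=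
    (hφ0'.mul (Asymptotics.IsEquivalent.refl
      (u := fun z : Fin (d + 1) → ℝ => (z 0 + k) / b (z 0)))).symm.tendsto_nhds (hβX.comp hx)
  have hφP : Tendsto (fun z => phiYproj d φ z) l (𝓝 c₀) := by
    refine Metric.tendsto_nhds.2 fun ε hε => ?_
    have h := eventually_bdryAtTop.2 (hφy (ε / 2 / c₀) (by positivity))
    filter_upwards [h] with z hz
    rw [div_mul_cancel₀ _ hc₀.ne'] at hz
    rw [Real.dist_eq]
    linarith
  refine ⟨fun z => ((1 + w * (1 - w) * b (z 0) ^ 2 / (2 * (z 0 + k) ^ 2)) -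
      (1 - w) * (b (z 0) / (z 0 + k)) ^ 2) * (φ z 0 * ((z 0 + k) / b (z 0))) -
      (1 - w) * phiYproj d φ z,
    fun z => ((z 0 + k) * (1 + w * (1 - w) * b (z 0) ^ 2 / (2 * (z 0 + k) ^ 2)) ^ (1 / w)) ^ (γ - 1) *
      (1 + w * (1 - w) * b (z 0) ^ 2 / (2 * (z 0 + k) ^ 2)) ^ (1 / w - 1) *
      (b (z 0) / (z 0 + k)), ?_, ?_⟩
  · have h := (((hu.comp hx).sub (((hbX.pow 2).const_mul (1 - w)).comp hx)).mul hφX).sub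
      (hφP.const_mul (1 - w))
    rw [zero_pow two_ne_zero, mul_zero, sub_zero, one_mul] at h
    exact h
  · filter_upwards [hbdry, hx.eventually_gt_atTop 0, hx.eventually (hX.eventually_gt_atTop 0),
      hx.eventually (hu.eventually (lt_mem_nhds one_pos))] with z hz hz0 hXz huz
    have hb := hbpos _ hz0
    have hyn : ynorm d z = b (z 0) := hz.2
    have hq : ynormSq d z = b (z 0) ^ 2 := by
      rw [← hyn, ynorm, Real.sq_sqrt]
      exact Finset.sum_nonneg fun i _ => sq_nonneg _
    have hS : ∑ j : Fin d, φ z j.succ * z j.succ = -(b (z 0) * phiYproj d φ z) := by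
      rw [phiYproj, hyn]
      field_simp
    refine ⟨by positivity, ?_⟩
    rw [sum_pderiv_mul, fderiv_fw_apply hw z (φ z) (X := z 0 + k) rfl (by rw [hq]) hXz huz, hq, hS]
    generalize 1 + w * (1 - w) * b (z 0) ^ 2 / (2 * (z 0 + k) ^ 2) = u
    generalize ((z 0 + k) * u ^ (1 / w)) ^ (γ - 1) = R
    generalize u ^ (1 / w - 1) = T
    field_simp
    ring

/-- **Sign of the boundary pairing of `f_{w,γ}` with the reflection field** (third claim
of Lemma 2.1): under (D2) and (V2), if `γ (s₀β/c₀ − 1 + w) < 0` (resp. `> 0`) then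
`⟨∇f_{w,γ}(z), φ(z)⟩ < 0` (resp. `> 0`) for all boundary points with large enough `x`. -/
theorem fw_boundary_pairing_sign (d : ℕ) (hd : 0 < d) (b : ℝ → ℝ) (β s₀ c₀ : ℝ)
    (φ : (Fin (d + 1) → ℝ) → Fin (d + 1) → ℝ)
    (hD2 : AssumpD2 b β) (hV2 : AssumpV2 d b φ s₀ c₀)
    (γ w : ℝ) (hw : w ≠ 0) :
    (γ * (s₀ * β / c₀ - 1 + w) < 0 →
      ∃ x₀ : ℝ, 0 < x₀ ∧ ∀ z ∈ Bdry d b, x₀ ≤ z 0 →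
        (∑ i, pderiv d (fw d b w γ) i z * φ z i) < 0) ∧
    (0 < γ * (s₀ * β / c₀ - 1 + w) →
      ∃ x₀ : ℝ, 0 < x₀ ∧ ∀ z ∈ Bdry d b, x₀ ≤ z 0 →
        0 < ∑ i, pderiv d (fw d b w γ) i z * φ z i) := by
  obtain ⟨g, p, hg, hp⟩ := exists_pairing_eq_mul hD2 hV2 γ hw
  have hc₀ : 0 < c₀ := hV2.2.2.1
  have hlim : γ * (s₀ * β - (1 - w) * c₀) = c₀ * (γ * (s₀ * β / c₀ - 1 + w)) := by
    field_simp
    ring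
  have hγg := hg.const_mul γ
  rw [hlim] at hγg
  have key : ∀ {q : (Fin (d + 1) → ℝ) → Prop}, (∀ᶠ z in bdryAtTop d b, q z) →
      ∃ x₀ : ℝ, 0 < x₀ ∧ ∀ z ∈ Bdry d b, x₀ ≤ z 0 → q z := by
    intro q hq
    obtain ⟨x₀, h⟩ := eventually_bdryAtTop.1 hq
    exact ⟨max x₀ 1, by positivity, fun z hz hx => h z hz ((le_max_left _ _).trans hx)⟩
  constructor
  · intro h
    refine key ?_
    filter_upwards [hp, hγg.eventually (gt_mem_nhds (mul_neg_of_pos_of_neg hc₀ h))] with z hz hz'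
    rw [hz.2]
    exact mul_neg_of_pos_of_neg hz.1 hz'
  · intro h
    refine key ?_
    filter_upwards [hp, hγg.eventually (lt_mem_nhds (mul_pos hc₀ h))] with z hz hz'
    rw [hz.2]
    exact mul_pos hz.1 hz'

end
end

section
/- Global boundary sign for the modified Lyapunov function F_{w,γ} (Lemma 2.3 of the paper). Assume (D2) and (V2), and fix γ ∈ ℝ and w ∈ ℝ∖{0} with γ·(βs₀/c₀ − 1 + w) < 0. Then there exist a constant k ∈ (0,∞) and constants 0 < x₀ < x₁ such that the function F_{w,γ} built from these constants satisfies ⟨∇F_{w,γ}(z), φ(z)⟩ ≤ 0 for all z ∈ ∂D. -/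
open Real Filter Set Topology

noncomputable section

/-- The smooth cutoff `m` determined by `0 < x₀ < x₁`. -/
def cutoff (x₀ x₁ x : ℝ) : ℝ :=
  if x₁ ≤ x then 1
  else if x ≤ x₀ then 0
  else Real.exp (((x₁ - x₀) ^ 2)⁻¹ - ((x₁ - x₀) ^ 2 - (x₁ - x) ^ 2)⁻¹)

/-- The modified Lyapunov function `F_{w,γ}(z) = f_{w,γ}(z) m(z) + k (1 − m(z))`. -/
def Fmod (d : ℕ) (b : ℝ → ℝ) (w γ k x₀ x₁ : ℝ) (z : Fin (d + 1) → ℝ) : ℝ :=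
  fw d b w γ z * cutoff x₀ x₁ (z 0) + k * (1 - cutoff x₀ x₁ (z 0))

/-- If the derivative of `b` tends to `0` at infinity, then `b` grows sublinearly. -/
theorem tendsto_div_id_of_tendsto_deriv_zero {b : ℝ → ℝ}
    (hd : ∀ x, 0 < x → DifferentiableAt ℝ b x) (h0 : Tendsto (deriv b) atTop (𝓝 0)) :
    Tendsto (fun x => b x / x) atTop (𝓝 0) := by
  rw [Metric.tendsto_atTop]
  intro ε hε
  obtain ⟨N, hN⟩ := (Metric.tendsto_atTop.1 h0) (ε / 2) (half_pos hε)
  set X := max N 1 with hX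
  have hX1 : 1 ≤ X := le_max_right _ _
  refine ⟨max X (2 * |b X| / ε + 1), fun x hx => ?_⟩
  have hxX : X ≤ x := (le_max_left _ _).trans hx
  have hx2 : 2 * |b X| / ε + 1 ≤ x := (le_max_right _ _).trans hx
  have hx0 : 0 < x := by linarith
  have hmv : ‖b x - b X‖ ≤ ε / 2 * ‖x - X‖ := by
    refine Convex.norm_image_sub_le_of_norm_deriv_le (s := Ici X) (fun y hy => hd y ?_)
      (fun y hy => ?_) (convex_Ici X) self_mem_Ici hxX
    · have : X ≤ y := hy
      linarith
    · have h := hN y ((le_max_left N 1).trans hy)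
      rw [dist_zero_right] at h
      exact h.le
  rw [Real.norm_eq_abs, Real.norm_eq_abs, abs_of_nonneg (sub_nonneg.2 hxX)] at hmv
  have hbx : |b x| ≤ |b X| + ε / 2 * (x - X) := by
    have := abs_sub_abs_le_abs_sub (b x) (b X)
    linarith
  have h3 : |b X| < ε / 2 * x := by
    have h4 : 2 * |b X| / ε < x := by linarith
    rw [div_lt_iff₀ hε] at h4
    linarith
  rw [dist_zero_right, Real.norm_eq_abs, abs_div, abs_of_pos hx0, div_lt_iff₀ hx0]
  nlinarith

theorem cutoff_eq_of_le {x₀ x₁ x : ℝ} (h : x₀ < x₁) (hx : x ≤ x₁) :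
    cutoff x₀ x₁ x =
      Real.exp (((x₁ - x₀) ^ 2)⁻¹) * expNegInvGlue ((x₁ - x₀) ^ 2 - (x₁ - x) ^ 2) := by
  unfold cutoff expNegInvGlue
  rcases hx.eq_or_lt with rfl | hlt
  · have : 0 < (x - x₀) ^ 2 := by have := sub_pos.2 h; positivity
    simp [this.not_ge, ← Real.exp_add]
  · rw [if_neg hlt.not_ge]
    by_cases hx0 : x ≤ x₀
    · rw [if_pos hx0, if_pos (by nlinarith), mul_zero]
    · rw [if_neg hx0, if_neg (by push Not at hx0 ⊢; nlinarith), ← Real.exp_add, sub_eq_add_neg]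

theorem cutoff_nonneg (x₀ x₁ x : ℝ) : 0 ≤ cutoff x₀ x₁ x := by
  unfold cutoff
  split_ifs <;> positivity

theorem cutoff_of_le {x₀ x₁ x : ℝ} (h : x₀ < x₁) (hx : x ≤ x₀) : cutoff x₀ x₁ x = 0 := by
  rw [cutoff, if_neg (by linarith), if_pos hx]

theorem cutoff_of_ge {x₀ x₁ x : ℝ} (hx : x₁ ≤ x) : cutoff x₀ x₁ x = 1 := by
  rw [cutoff, if_pos hx]

theorem hasDerivAt_cutoff_of_mem_Ioo {x₀ x₁ x : ℝ} (hx : x ∈ Ioo x₀ x₁) :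
    HasDerivAt (cutoff x₀ x₁)
      (cutoff x₀ x₁ x * (2 * (x₁ - x) / ((x₁ - x₀) ^ 2 - (x₁ - x) ^ 2) ^ 2)) x := by
  obtain ⟨h0, h1⟩ := hx
  have hev : cutoff x₀ x₁ =ᶠ[𝓝 x] fun x =>
      Real.exp (((x₁ - x₀) ^ 2)⁻¹ - ((x₁ - x₀) ^ 2 - (x₁ - x) ^ 2)⁻¹) := by
    filter_upwards [Ioo_mem_nhds h0 h1] with y hy
    rw [cutoff, if_neg hy.2.not_ge, if_neg hy.1.not_ge]
  have hne : (x₁ - x₀) ^ 2 - (x₁ - x) ^ 2 ≠ 0 := by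
    have : 0 < (x₁ - x₀) ^ 2 - (x₁ - x) ^ 2 := by nlinarith
    exact this.ne'
  rw [hev.eq_of_nhds]
  refine HasDerivAt.congr_of_eventuallyEq ?_ hev
  have h := ((((((hasDerivAt_id x).const_sub x₁).pow 2).const_sub ((x₁ - x₀) ^ 2)).inv
    hne).const_sub (((x₁ - x₀) ^ 2)⁻¹)).exp
  refine h.congr_deriv ?_
  simp only [id, Pi.pow_apply, Pi.inv_apply]
  push_cast
  ring

theorem hasDerivAt_cutoff_left {x₀ x₁ : ℝ} (h : x₀ < x₁) :
    HasDerivAt (cutoff x₀ x₁) 0 x₀ := by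
  have hev : cutoff x₀ x₁ =ᶠ[𝓝 x₀] fun x =>
      Real.exp (((x₁ - x₀) ^ 2)⁻¹) * expNegInvGlue ((x₁ - x₀) ^ 2 - (x₁ - x) ^ 2) := by
    filter_upwards [Iio_mem_nhds h] with y hy using cutoff_eq_of_le h (le_of_lt hy)
  have hdiff : DifferentiableAt ℝ (cutoff x₀ x₁) x₀ := by
    refine DifferentiableAt.congr_of_eventuallyEq ?_ hev
    have := (expNegInvGlue.contDiff (n := 1)).differentiable one_ne_zero
    fun_prop
  have hmin : IsLocalMin (cutoff x₀ x₁) x₀ := by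
    refine Eventually.of_forall fun y => ?_
    rw [cutoff_of_le h le_rfl]
    exact cutoff_nonneg _ _ _
  simpa [hmin.deriv_eq_zero] using hdiff.hasDerivAt

theorem hasDerivAt_cutoff_of_ge {x₀ x₁ x : ℝ} (h : x₀ < x₁) (hx : x₁ ≤ x) :
    HasDerivAt (cutoff x₀ x₁) 0 x := by
  rcases hx.eq_or_lt with rfl | hlt
  · have hr : HasDerivWithinAt (cutoff x₀ x₁) 0 (Ici x₁) x₁ :=
      (hasDerivWithinAt_const x₁ _ (1 : ℝ)).congr (fun y hy => cutoff_of_ge hy)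
        (cutoff_of_ge le_rfl)
    have hg : HasDerivAt (fun x => Real.exp (((x₁ - x₀) ^ 2)⁻¹) *
        expNegInvGlue ((x₁ - x₀) ^ 2 - (x₁ - x) ^ 2)) 0 x₁ := by
      have hd := ((expNegInvGlue.contDiff (n := 1)).differentiable one_ne_zero
        ((x₁ - x₀) ^ 2 - (x₁ - x₁) ^ 2)).hasDerivAt
      have hi : HasDerivAt (fun x => (x₁ - x₀) ^ 2 - (x₁ - x) ^ 2) 0 x₁ := by
        simpa using (((hasDerivAt_id x₁).const_sub x₁).pow 2).const_sub ((x₁ - x₀) ^ 2)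
      simpa using (hd.comp x₁ hi).const_mul (Real.exp (((x₁ - x₀) ^ 2)⁻¹))
    have hl : HasDerivWithinAt (cutoff x₀ x₁) 0 (Iic x₁) x₁ :=
      hg.hasDerivWithinAt.congr (fun y hy => cutoff_eq_of_le h hy) (cutoff_eq_of_le h le_rfl)
    have := hl.union hr
    rwa [Iic_union_Ici, hasDerivWithinAt_univ] at this
  · refine (hasDerivAt_const x (1 : ℝ)).congr_of_eventuallyEq ?_
    filter_upwards [Ioi_mem_nhds hlt] with y hy using cutoff_of_ge (le_of_lt hy)

/-- The sum of the partial derivatives against `v` is any derivative of `f` along the line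
`t ↦ z + t v`, unless `f` fails to be differentiable and the sum vanishes. -/
theorem sum_pderiv_mul_le_zero {d : ℕ} {f : (Fin (d + 1) → ℝ) → ℝ} {z v : Fin (d + 1) → ℝ}
    {f' : ℝ} (hf : HasDerivAt (fun t : ℝ => f (z + t • v)) f' 0) (hf' : f' ≤ 0) :
    ∑ i, pderiv d f i z * v i ≤ 0 := by
  by_cases hd : DifferentiableAt ℝ f z
  · have hsum : ∑ i, pderiv d f i z * v i = fderiv ℝ f z v := by
      conv_rhs => rw [pi_eq_sum_univ' v, map_sum]
      refine Finset.sum_congr rfl fun i _ => ?_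
      rw [map_smul, smul_eq_mul, mul_comm, pderiv]
    have hline : HasDerivAt (fun t : ℝ => f (z + t • v)) (fderiv ℝ f z v) 0 :=
      hd.hasFDerivAt.hasLineDerivAt v
    rw [hsum, hline.unique hf]
    exact hf'
  · simp [pderiv, fderiv_zero_of_not_differentiableAt hd]

/-- The derivative of `log f_{w,1}` at a point at `x`-coordinate `x` (shifted by `κ`) in terms of
`A = w(1-w)‖y‖²/(2(x+κ)²)`, the `x`-component `v₀` and `p = ⟨v, -y⟩`. -/
def logDerivFw (w κ x A v₀ p : ℝ) : ℝ :=
  v₀ / (x + κ) * (1 - 2 * A / (w * (1 + A))) - (1 - w) * p / ((x + κ) ^ 2 * (1 + A))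

theorem hasDerivAt_fw_line {d : ℕ} {b : ℝ → ℝ} {w : ℝ} (hw : w ≠ 0) (γ : ℝ)
    {z v : Fin (d + 1) → ℝ} (hx : 0 < z 0 + kw b w)
    (hA : 0 < 1 + w * (1 - w) * ynormSq d z / (2 * (z 0 + kw b w) ^ 2)) :
    HasDerivAt (fun t : ℝ => fw d b w γ (z + t • v))
      (fw d b w γ z * (γ * logDerivFw w (kw b w) (z 0)
        (w * (1 - w) * ynormSq d z / (2 * (z 0 + kw b w) ^ 2)) (v 0)
        (-∑ j : Fin d, v j.succ * z j.succ))) 0 := by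
  set κ := kw b w
  have h0 : HasDerivAt (fun t : ℝ => (z + t • v) 0 + κ) (v 0) 0 := by
    simpa using (((hasDerivAt_id (0 : ℝ)).mul_const (v 0)).const_add (z 0)).add_const κ
  have hq : HasDerivAt (fun t : ℝ => ynormSq d (z + t • v))
      (2 * ∑ j : Fin d, v j.succ * z j.succ) 0 := by
    rw [Finset.mul_sum]
    unfold ynormSq
    refine HasDerivAt.fun_sum fun j _ => ?_
    have := (((hasDerivAt_id (0 : ℝ)).mul_const (v j.succ)).const_add (z j.succ)).pow 2
    refine this.congr_deriv ?_
    simp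
    ring
  have hz : z + (0 : ℝ) • v = z := by simp
  have hden : 2 * ((z + (0 : ℝ) • v) 0 + κ) ^ 2 ≠ 0 := by rw [hz]; positivity
  have hin := ((hq.const_mul (w * (1 - w))).div ((h0.pow 2).const_mul 2) hden).const_add 1
  have hr := hin.rpow_const (p := 1 / w) (Or.inl (by simpa [hz] using hA.ne'))
  have h1 := h0.mul hr
  have hpos : 0 < fw1 d b w z := mul_pos hx (rpow_pos_of_pos hA _)
  have h2 := h1.rpow_const (p := γ) (Or.inl (by
    simp only [Pi.mul_apply, Pi.pow_apply, Pi.div_apply, hz]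
    exact hpos.ne'))
  refine h2.congr_deriv ?_
  simp only [Pi.mul_apply, Pi.pow_apply, Pi.div_apply, hz]
  have e1 : fw1 d b w z = (z 0 + κ) *
    (1 + w * (1 - w) * ynormSq d z / (2 * (z 0 + κ) ^ 2)) ^ (1 / w) := rfl
  have e2 : fw d b w γ z = fw1 d b w z ^ γ := rfl
  rw [e2, ← e1, rpow_sub_one hpos.ne', rpow_sub_one hA.ne', e1, logDerivFw]
  set q := ynormSq d z
  set S := ∑ j : Fin d, v j.succ * z j.succ
  set A := w * (1 - w) * q / (2 * (z 0 + κ) ^ 2) with hAdef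
  set R := (1 + A) ^ (1 / w) with hR
  have hRpos : 0 < R := rpow_pos_of_pos hA _
  have hq' : w * (1 - w) * q = A * (2 * (z 0 + κ) ^ 2) := by
    rw [hAdef]; field_simp
  rw [hq']
  generalize ((z 0 + κ) * R) ^ γ = G
  have hX : z 0 + κ ≠ 0 := hx.ne'
  have hA' : 1 + A ≠ 0 := hA.ne'
  have hR' : R ≠ 0 := hRpos.ne'
  generalize z 0 + κ = X at *
  clear_value A R S
  field_simp
  push_cast
  ring

theorem tendsto_fst_bdryAtTop (d : ℕ) (b : ℝ → ℝ) :
    Tendsto (fun z : Fin (d + 1) → ℝ => z 0) (bdryAtTop d b) atTop :=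
  tendsto_comap.mono_left inf_le_left

theorem eventually_mem_bdryAtTop (d : ℕ) (b : ℝ → ℝ) : ∀ᶠ z in bdryAtTop d b, z ∈ Bdry d b :=
  mem_inf_of_right (mem_principal_self _)

theorem eventually_bdryAtTop_iff {d : ℕ} {b : ℝ → ℝ} {p : (Fin (d + 1) → ℝ) → Prop} :
    (∀ᶠ z in bdryAtTop d b, p z) ↔ ∃ X : ℝ, ∀ z ∈ Bdry d b, X ≤ z 0 → p z := by
  rw [bdryAtTop, eventually_inf_principal, eventually_comap, eventually_atTop]
  constructor
  · rintro ⟨X, hX⟩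
    exact ⟨X, fun z hz hXz => hX _ hXz z rfl hz⟩
  · rintro ⟨X, hX⟩
    refine ⟨X, ?_⟩
    rintro _ hx z rfl hz
    exact hX z hz hx

/-- The quantity `A = w(1-w)b(x)²/(2(x+κ)²)` along the boundary. -/
def bdryRatio (b : ℝ → ℝ) (w x : ℝ) : ℝ := w * (1 - w) * b x ^ 2 / (2 * (x + kw b w) ^ 2)

theorem ynormSq_of_mem_Bdry {d : ℕ} {b : ℝ → ℝ} {z : Fin (d + 1) → ℝ} (hz : z ∈ Bdry d b) :
    ynormSq d z = b (z 0) ^ 2 := by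
  rw [← hz.2, ynorm, sq_sqrt]
  exact Finset.sum_nonneg fun i _ => sq_nonneg _

theorem tendsto_div_add_const (κ : ℝ) : Tendsto (fun x : ℝ => x / (x + κ)) atTop (𝓝 1) := by
  have h : Tendsto (fun x : ℝ => 1 - κ / (x + κ)) atTop (𝓝 (1 - 0)) :=
    tendsto_const_nhds.sub ((tendsto_atTop_add_const_right _ κ tendsto_id).const_div_atTop κ)
  rw [sub_zero] at h
  refine h.congr' ?_
  filter_upwards [eventually_gt_atTop (-κ)] with x hx
  have : x + κ ≠ 0 := by linarith
  field_simp
  ring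

theorem tendsto_bdryRatio {b : ℝ → ℝ} (w : ℝ) (hb : Tendsto (fun x => b x / x) atTop (𝓝 0)) :
    Tendsto (bdryRatio b w) atTop (𝓝 0) := by
  have h := ((hb.mul (tendsto_div_add_const (kw b w))).pow 2).const_mul (w * (1 - w) / 2)
  simp only [zero_mul, ne_eq, OfNat.ofNat_ne_zero, not_false_eq_true, zero_pow, mul_zero] at h
  refine h.congr' ?_
  filter_upwards [eventually_gt_atTop 0, eventually_gt_atTop (-kw b w)] with x hx hx'
  have : x + kw b w ≠ 0 := by linarith
  rw [bdryRatio]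
  field_simp

section Asymptotics

variable {d : ℕ} {b : ℝ → ℝ} {β s₀ c₀ : ℝ} {φ : (Fin (d + 1) → ℝ) → Fin (d + 1) → ℝ}

theorem AssumpD2.differentiableAt (hD2 : AssumpD2 b β) {x : ℝ} (hx : 0 < x) :
    DifferentiableAt ℝ b x :=
  (hD2.1.2.2.2.1.differentiableOn two_ne_zero).differentiableAt (Ioi_mem_nhds hx)

theorem AssumpD2.continuousAt_deriv (hD2 : AssumpD2 b β) {x : ℝ} (hx : 0 < x) :
    ContinuousAt (deriv b) x :=
  (hD2.1.2.2.2.1.continuousOn_deriv_of_isOpen isOpen_Ioi one_le_two).continuousAt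
    (Ioi_mem_nhds hx)

theorem AssumpD2.pos (hD2 : AssumpD2 b β) {x : ℝ} (hx : 0 < x) : 0 < b x := hD2.1.2.2.1 x hx

theorem AssumpD2.tendsto_div (hD2 : AssumpD2 b β) : Tendsto (fun x => b x / x) atTop (𝓝 0) :=
  tendsto_div_id_of_tendsto_deriv_zero (fun _ hx => hD2.differentiableAt hx) hD2.2.1

theorem tendsto_mul_phi_fst_div (hD2 : AssumpD2 b β) (hV2 : AssumpV2 d b φ s₀ c₀) :
    Tendsto (fun z => z 0 * φ z 0 / b (z 0)) (bdryAtTop d b) (𝓝 (β * s₀)) := by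
  have hlim := hD2.2.2.2.2.comp (tendsto_fst_bdryAtTop d b)
  have hlo : (fun z => φ z 0 - s₀ * deriv b (z 0)) =o[bdryAtTop d b]
      fun z => s₀ * deriv b (z 0) := by
    rw [Asymptotics.isLittleO_iff]
    intro ε hε
    exact eventually_bdryAtTop_iff.2 (hV2.2.2.2.1 ε hε)
  have hlo' := ((Asymptotics.isBigO_refl (fun z : Fin (d + 1) → ℝ => z 0 / b (z 0))
    (bdryAtTop d b)).mul_isLittleO hlo).trans_isBigO
    (g := fun z : Fin (d + 1) → ℝ => z 0 / b (z 0) * (s₀ * deriv b (z 0))) (k := fun _ => (1 : ℝ)) (by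
      refine (Tendsto.congr (fun z => ?_) (hlim.mul_const s₀)).isBigO_one ℝ
      simp only [Function.comp]
      ring)
  have h0 := (Asymptotics.isLittleO_one_iff ℝ).1 hlo'
  have := h0.add (hlim.mul_const s₀)
  rw [zero_add] at this
  refine this.congr fun z => ?_
  simp only [Function.comp]
  ring

theorem tendsto_phiYproj (hV2 : AssumpV2 d b φ s₀ c₀) :
    Tendsto (phiYproj d φ) (bdryAtTop d b) (𝓝 c₀) := by
  have hc := hV2.2.2.1
  rw [Metric.tendsto_nhds]
  intro ε hε
  have h := eventually_bdryAtTop_iff.2 (hV2.2.2.2.2 (ε / (2 * c₀)) (by positivity))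
  filter_upwards [h] with z hz
  rw [Real.dist_eq]
  have : ε / (2 * c₀) * c₀ = ε / 2 := by field_simp
  linarith

theorem tendsto_logDerivFw (hD2 : AssumpD2 b β) (hV2 : AssumpV2 d b φ s₀ c₀) (w : ℝ) :
    Tendsto (fun z => logDerivFw w (kw b w) (z 0)
      (w * (1 - w) * ynormSq d z / (2 * (z 0 + kw b w) ^ 2)) (φ z 0)
      (-∑ j : Fin d, φ z j.succ * z j.succ) * (z 0 ^ 2 / b (z 0)))
      (bdryAtTop d b) (𝓝 (β * s₀ - (1 - w) * c₀)) := by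
  have hx := tendsto_fst_bdryAtTop d b
  have hA := (tendsto_bdryRatio w hD2.tendsto_div).comp hx
  have hr := (tendsto_div_add_const (kw b w)).comp hx
  have hv := tendsto_mul_phi_fst_div hD2 hV2
  have hp := tendsto_phiYproj hV2
  have hA1 := hA.const_add 1
  rw [add_zero] at hA1
  have h1 := (hr.mul hv).mul
    ((((hA.div hA1 one_ne_zero).const_mul (2 / w)).const_sub 1))
  have h2 := ((hp.mul (hr.pow 2)).div hA1 one_ne_zero).const_mul (1 - w)
  have h := h1.sub h2
  have e : 1 * (β * s₀) * (1 - 2 / w * (0 / 1)) - (1 - w) * (c₀ * 1 ^ 2 / 1) =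
    β * s₀ - (1 - w) * c₀ := by ring
  rw [e] at h
  refine h.congr' ?_
  filter_upwards [eventually_mem_bdryAtTop d b, hx.eventually_gt_atTop 0] with z hz hz0
  have hb := hD2.pos hz0
  have hS : -∑ j : Fin d, φ z j.succ * z j.succ = phiYproj d φ z * b (z 0) := by
    rw [phiYproj, hz.2, div_mul_cancel₀ _ hb.ne']
  rw [hS, ynormSq_of_mem_Bdry hz]
  simp only [Function.comp, Pi.div_apply, logDerivFw, ← bdryRatio.eq_1]
  have hcancel : ∀ D : ℝ, (1 - w) * (phiYproj d φ z * b (z 0)) / D * (z 0 ^ 2 / b (z 0)) =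
      (1 - w) * phiYproj d φ z * z 0 ^ 2 / D := fun D => by field_simp
  rw [sub_mul (φ z 0 / _ * _), hcancel]
  generalize 1 + bdryRatio b w (z 0) = T
  generalize z 0 + kw b w = Y
  ring

/-- Bounds valid on the part `X ≤ x` of the boundary: the derivative of `log f_{w,γ}` along `φ` is
at most `-c b(x)/x²`, and the `x`-component of `φ` has the sign of `b'` and is at most
`C b(x)/x`. -/
structure BdryBounds (d : ℕ) (b : ℝ → ℝ) (φ : (Fin (d + 1) → ℝ) → Fin (d + 1) → ℝ)
    (w γ X c C : ℝ) : Prop where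
  X_pos : 0 < X
  c_pos : 0 < c
  C_pos : 0 < C
  shift_pos : ∀ x, X ≤ x → 0 < x + kw b w
  base_pos : ∀ x, X ≤ x → 0 < 1 + bdryRatio b w x
  logDeriv_le : ∀ z ∈ Bdry d b, X ≤ z 0 →
    γ * logDerivFw w (kw b w) (z 0) (w * (1 - w) * ynormSq d z / (2 * (z 0 + kw b w) ^ 2))
      (φ z 0) (-∑ j : Fin d, φ z j.succ * z j.succ) ≤ -(c * (b (z 0) / z 0 ^ 2))
  fst_le : ∀ z ∈ Bdry d b, X ≤ z 0 → φ z 0 ≤ C * (b (z 0) / z 0)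
  fst_nonneg : ∀ z ∈ Bdry d b, X ≤ z 0 → 0 ≤ deriv b (z 0) → 0 ≤ φ z 0
  fst_nonpos : ∀ z ∈ Bdry d b, X ≤ z 0 → deriv b (z 0) ≤ 0 → φ z 0 ≤ 0

theorem exists_bdryBounds (hD2 : AssumpD2 b β) (hV2 : AssumpV2 d b φ s₀ c₀) {γ w : ℝ}
    (hsign : γ * (β * s₀ / c₀ - 1 + w) < 0) :
    ∃ X c C : ℝ, BdryBounds d b φ w γ X c C := by
  have hs₀ := hV2.2.1
  have hc₀ := hV2.2.2.1
  have hS : γ * (β * s₀ - (1 - w) * c₀) < 0 := by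
    have : γ * (β * s₀ - (1 - w) * c₀) = γ * (β * s₀ / c₀ - 1 + w) * c₀ := by
      field_simp
      ring
    rw [this]
    exact mul_neg_of_neg_of_pos hsign hc₀
  set S := γ * (β * s₀ - (1 - w) * c₀)
  obtain ⟨X₁, hX₁⟩ := eventually_bdryAtTop_iff.1
    (((tendsto_logDerivFw hD2 hV2 w).const_mul γ).eventually_lt_const
      (show S < S / 2 by linarith))
  obtain ⟨X₂, hX₂⟩ := eventually_bdryAtTop_iff.1
    ((tendsto_mul_phi_fst_div hD2 hV2).eventually_lt_const
      (show β * s₀ < |β * s₀| + 1 by linarith [le_abs_self (β * s₀)]))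
  obtain ⟨X₃, hX₃⟩ := hV2.2.2.2.1 1 one_pos
  obtain ⟨X₄, hX₄⟩ := eventually_atTop.1
    ((tendsto_bdryRatio w hD2.tendsto_div).eventually_const_lt (show (-1 : ℝ) < 0 by norm_num))
  obtain ⟨X, hX⟩ := eventually_atTop.1 ((eventually_ge_atTop X₁).and
    ((eventually_ge_atTop X₂).and ((eventually_ge_atTop X₃).and ((eventually_ge_atTop X₄).and
    ((eventually_gt_atTop 0).and (eventually_gt_atTop (-kw b w)))))))
  refine ⟨X, -S / 2, |β * s₀| + 1, (hX X le_rfl).2.2.2.2.1, by linarith, by positivity,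
    fun x hx => ?_, fun x hx => ?_, fun z hz hx => ?_, fun z hz hx => ?_, fun z hz hx hb' => ?_,
    fun z hz hx hb' => ?_⟩
  · linarith [(hX x hx).2.2.2.2.2]
  · linarith [hX₄ x (hX x hx).2.2.2.1]
  · have h0 := (hX _ hx).2.2.2.2.1
    have hb := hD2.pos h0
    have h := hX₁ z hz (hX _ hx).1
    rw [← mul_assoc, ← lt_div_iff₀ (by positivity)] at h
    refine h.le.trans_eq ?_
    field_simp
  · have h0 := (hX _ hx).2.2.2.2.1
    have hb := hD2.pos h0
    have h := hX₂ z hz (hX _ hx).2.1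
    rw [div_lt_iff₀ hb] at h
    rw [← mul_div_assoc, le_div_iff₀ h0]
    linarith
  · have h := hX₃ z hz (hX _ hx).2.2.1
    rw [abs_of_nonneg (mul_nonneg hs₀.le hb'), one_mul] at h
    linarith [neg_le_of_abs_le h]
  · have h := hX₃ z hz (hX _ hx).2.2.1
    rw [abs_of_nonpos (mul_nonpos_of_nonneg_of_nonpos hs₀.le hb'), one_mul] at h
    linarith [le_of_abs_le h]

end Asymptotics

/-- The restriction of `f_{w,γ}` to the boundary, as a function of `x`. -/
def bdryFw (b : ℝ → ℝ) (w γ x : ℝ) : ℝ :=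
  ((x + kw b w) * (1 + bdryRatio b w x) ^ (1 / w)) ^ γ

theorem fw_of_mem_Bdry {d : ℕ} {b : ℝ → ℝ} (w γ : ℝ) {z : Fin (d + 1) → ℝ}
    (hz : z ∈ Bdry d b) : fw d b w γ z = bdryFw b w γ (z 0) := by
  rw [fw, fw1, ynormSq_of_mem_Bdry hz, bdryFw, bdryRatio]

namespace BdryBounds

variable {d : ℕ} {b : ℝ → ℝ} {φ : (Fin (d + 1) → ℝ) → Fin (d + 1) → ℝ} {w γ X c C : ℝ}

theorem bdryFw_pos (h : BdryBounds d b φ w γ X c C) {x : ℝ} (hx : X ≤ x) :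
    0 < bdryFw b w γ x :=
  rpow_pos_of_pos (mul_pos (h.shift_pos x hx) (rpow_pos_of_pos (h.base_pos x hx) _)) _

theorem continuousOn_bdryFw (h : BdryBounds d b φ w γ X c C) (hb : ContinuousOn b (Ici 0)) :
    ContinuousOn (bdryFw b w γ) (Ici X) := by
  have hb' : ContinuousOn b (Ici X) := hb.mono (Ici_subset_Ici.2 h.X_pos.le)
  have hr : ContinuousOn (bdryRatio b w) (Ici X) := by
    unfold bdryRatio
    refine ContinuousOn.div (by fun_prop) (by fun_prop) fun x hx => ?_
    have := h.shift_pos x hx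
    positivity
  refine ContinuousOn.rpow_const (ContinuousOn.mul (by fun_prop)
    (ContinuousOn.rpow_const (by fun_prop) fun x hx => Or.inl (h.base_pos x hx).ne'))
    fun x hx => Or.inl ?_
  exact (mul_pos (h.shift_pos x hx) (rpow_pos_of_pos (h.base_pos x hx) _)).ne'

theorem hasDerivAt_Fmod_line (h : BdryBounds d b φ w γ X c C) (hw : w ≠ 0) {k x₀ x₁ M : ℝ}
    {z : Fin (d + 1) → ℝ} (hz : z ∈ Bdry d b) (hX : X ≤ z 0)
    (hM : HasDerivAt (cutoff x₀ x₁) M (z 0)) :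
    ∃ P : ℝ, P ≤ -(c * (b (z 0) / z 0 ^ 2)) ∧
      HasDerivAt (fun t : ℝ => Fmod d b w γ k x₀ x₁ (z + t • φ z))
        (bdryFw b w γ (z 0) * P * cutoff x₀ x₁ (z 0) +
          (bdryFw b w γ (z 0) - k) * (M * φ z 0)) 0 := by
  have hbase := h.base_pos _ hX
  rw [bdryRatio, ← ynormSq_of_mem_Bdry hz] at hbase
  refine ⟨_, h.logDeriv_le z hz hX, ?_⟩
  have hf := hasDerivAt_fw_line hw γ (v := φ z) (h.shift_pos _ hX) hbase
  have h0 : HasDerivAt (fun t : ℝ => (z + t • φ z) 0) (φ z 0) 0 := by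
    simpa using ((hasDerivAt_id (0 : ℝ)).mul_const (φ z 0)).const_add (z 0)
  have hz0 : z + (0 : ℝ) • φ z = z := by simp
  have hm : HasDerivAt (fun t : ℝ => cutoff x₀ x₁ ((z + t • φ z) 0)) (M * φ z 0) 0 :=
    HasDerivAt.comp (0 : ℝ) (h₂ := cutoff x₀ x₁) (by rwa [hz0]) h0
  refine ((hf.mul hm).add ((hm.const_sub 1).const_mul k)).congr_deriv ?_
  rw [hz0, fw_of_mem_Bdry w γ hz]
  ring

/-- It suffices to control the cutoff term on the transition region `x₀ < x < x₁`. -/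
theorem sum_pderiv_Fmod_nonpos (h : BdryBounds d b φ w γ X c C) (hw : w ≠ 0)
    (hb : ∀ x, 0 < x → 0 < b x) {k x₀ x₁ : ℝ} (hX : X ≤ x₀) (hx : x₀ < x₁)
    (H : ∀ z ∈ Bdry d b, z 0 ∈ Ioo x₀ x₁ →
      (bdryFw b w γ (z 0) - k) *
          (2 * (x₁ - z 0) / ((x₁ - x₀) ^ 2 - (x₁ - z 0) ^ 2) ^ 2 * φ z 0) ≤
        bdryFw b w γ (z 0) * (c * (b (z 0) / z 0 ^ 2)))
    {z : Fin (d + 1) → ℝ} (hz : z ∈ Bdry d b) :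
    ∑ i, pderiv d (Fmod d b w γ k x₀ x₁) i z * φ z i ≤ 0 := by
  have hneg : ∀ P, X ≤ z 0 → P ≤ -(c * (b (z 0) / z 0 ^ 2)) →
      bdryFw b w γ (z 0) * P * cutoff x₀ x₁ (z 0) ≤ 0 := fun P hXz hP => by
    have h1 := h.bdryFw_pos hXz
    have h2 := hb (z 0) (h.X_pos.trans_le hXz)
    have h3 : 0 ≤ c * (b (z 0) / z 0 ^ 2) := mul_nonneg h.c_pos.le (by positivity)
    exact mul_nonpos_of_nonpos_of_nonneg
      (mul_nonpos_of_nonneg_of_nonpos h1.le (by linarith)) (cutoff_nonneg _ _ _)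
  rcases lt_trichotomy (z 0) x₀ with hlt | heq | hgt
  · refine sum_pderiv_mul_le_zero (f' := 0) ?_ le_rfl
    refine (hasDerivAt_const (0 : ℝ) k).congr_of_eventuallyEq ?_
    have hcont : ContinuousAt (fun t : ℝ => (z + t • φ z) 0) 0 := by
      simp only [Pi.add_apply, Pi.smul_apply, smul_eq_mul]
      fun_prop
    have hlt' : (z + (0 : ℝ) • φ z) 0 < x₀ := by simpa using hlt
    filter_upwards [hcont.eventually_lt_const hlt'] with t ht
    rw [Fmod, cutoff_of_le hx (le_of_lt ht)]
    ring
  · obtain ⟨P, hP, hder⟩ := h.hasDerivAt_Fmod_line hw (k := k) hz (heq ▸ hX)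
      (by rw [heq]; exact hasDerivAt_cutoff_left hx)
    refine sum_pderiv_mul_le_zero hder ?_
    simpa using hneg P (hX.trans_eq heq.symm) hP
  · have hXz : X ≤ z 0 := hX.trans hgt.le
    rcases lt_or_ge (z 0) x₁ with hlt | hge
    · obtain ⟨P, hP, hder⟩ := h.hasDerivAt_Fmod_line hw (k := k) hz hXz
        (hasDerivAt_cutoff_of_mem_Ioo ⟨hgt, hlt⟩)
      refine sum_pderiv_mul_le_zero hder ?_
      have h1 := mul_le_mul_of_nonneg_left hP (h.bdryFw_pos hXz).le
      have h2 := H z hz ⟨hgt, hlt⟩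
      have h3 := mul_nonpos_of_nonneg_of_nonpos (cutoff_nonneg x₀ x₁ (z 0))
        (show bdryFw b w γ (z 0) * P + (bdryFw b w γ (z 0) - k) *
          (2 * (x₁ - z 0) / ((x₁ - x₀) ^ 2 - (x₁ - z 0) ^ 2) ^ 2 * φ z 0) ≤ 0 by linarith)
      linarith
    · obtain ⟨P, hP, hder⟩ := h.hasDerivAt_Fmod_line hw (k := k) hz hXz
        (hasDerivAt_cutoff_of_ge hx hge)
      refine sum_pderiv_mul_le_zero hder ?_
      simpa using hneg P hXz hP

end BdryBounds

/-- The logarithmic derivative of the cutoff at distance `t ≥ δ` from `x₀` is of order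
`1 / (t² L)`, where `L = x₁ - x₀`. -/
theorem logDeriv_cutoff_mul_le {x₀ δ L x c C : ℝ} (hx₀ : 0 < x₀) (hδ : 0 < δ) (hL : 0 < L)
    (hc : 0 < c) (hC : 0 < C) (hLC : 2 * C * (x₀ + δ) / (c * δ ^ 2) ≤ L)
    (h₁ : x₀ + δ ≤ x) (h₂ : x < x₀ + L) :
    2 * (x₀ + L - x) / (L ^ 2 - (x₀ + L - x) ^ 2) ^ 2 * C ≤ c / x := by
  obtain ⟨t, rfl⟩ : ∃ t, x = x₀ + t := ⟨x - x₀, by ring⟩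
  have ht : δ ≤ t := by linarith
  have ht0 : 0 < t := hδ.trans_le ht
  have htL : t < L := by linarith
  have hu : 2 * (x₀ + L - (x₀ + t)) / (L ^ 2 - (x₀ + L - (x₀ + t)) ^ 2) ^ 2 ≤
      2 / (t ^ 2 * L) := by
    have hh : t * L ≤ L ^ 2 - (x₀ + L - (x₀ + t)) ^ 2 := by nlinarith
    calc 2 * (x₀ + L - (x₀ + t)) / (L ^ 2 - (x₀ + L - (x₀ + t)) ^ 2) ^ 2
        ≤ 2 * L / (t * L) ^ 2 := by
          gcongr
          linarith
      _ = 2 / (t ^ 2 * L) := by field_simp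
  refine (mul_le_mul_of_nonneg_right hu hC.le).trans ?_
  rw [div_mul_eq_mul_div, div_le_div_iff₀ (by positivity) (by positivity)]
  rw [div_le_iff₀ (by positivity)] at hLC
  have hmono : (x₀ + t) * δ ^ 2 ≤ (x₀ + δ) * t ^ 2 := by
    have : 0 ≤ t - δ := by linarith
    have e : (x₀ + δ) * t ^ 2 - (x₀ + t) * δ ^ 2 = (t - δ) * (x₀ * (t + δ) + δ * t) := by ring
    have : 0 ≤ (t - δ) * (x₀ * (t + δ) + δ * t) := by positivity
    linarith
  have h3 : 2 * C * (x₀ + t) * δ ^ 2 ≤ c * (t ^ 2 * L) * δ ^ 2 := by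
    calc 2 * C * (x₀ + t) * δ ^ 2 = 2 * C * ((x₀ + t) * δ ^ 2) := by ring
      _ ≤ 2 * C * ((x₀ + δ) * t ^ 2) := by gcongr
      _ = 2 * C * (x₀ + δ) * t ^ 2 := by ring
      _ ≤ L * (c * δ ^ 2) * t ^ 2 := by gcongr
      _ = c * (t ^ 2 * L) * δ ^ 2 := by ring
  exact le_of_mul_le_mul_right h3 (by positivity)

/-- **Global boundary sign for the modified Lyapunov function `F_{w,γ}`** (Lemma 2.3):
under (D2) and (V2), if `γ (β s₀/c₀ − 1 + w) < 0` then there exist `k ∈ (0,∞)` and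
`0 < x₀ < x₁` such that `⟨∇F_{w,γ}(z), φ(z)⟩ ≤ 0` for all `z ∈ ∂D`. -/
theorem Fmod_boundary_sign (d : ℕ) (hd : 0 < d) (b : ℝ → ℝ) (β s₀ c₀ : ℝ)
    (φ : (Fin (d + 1) → ℝ) → Fin (d + 1) → ℝ)
    (hD2 : AssumpD2 b β) (hV2 : AssumpV2 d b φ s₀ c₀)
    (γ w : ℝ) (hw : w ≠ 0)
    (hsign : γ * (β * s₀ / c₀ - 1 + w) < 0) :
    ∃ k : ℝ, 0 < k ∧ ∃ x₀ x₁ : ℝ, 0 < x₀ ∧ x₀ < x₁ ∧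
      ∀ z ∈ Bdry d b, (∑ i, pderiv d (Fmod d b w γ k x₀ x₁) i z * φ z i) ≤ 0 := by
  obtain ⟨X, c, C, h⟩ := exists_bdryBounds hD2 hV2 hsign
  have hb : ∀ x, 0 < x → 0 < b x := fun x hx => hD2.pos hx
  have hcont := h.continuousOn_bdryFw hD2.1.1
  have hrate : ∀ x₀ x₁ x : ℝ, x ∈ Ioo x₀ x₁ →
      0 ≤ 2 * (x₁ - x) / ((x₁ - x₀) ^ 2 - (x₁ - x) ^ 2) ^ 2 := fun x₀ x₁ x hx => by
    have := sub_pos.2 hx.2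
    positivity
  have hright : ∀ x, X ≤ x → 0 ≤ bdryFw b w γ x * (c * (b x / x ^ 2)) := fun x hx => by
    have h0 := h.X_pos.trans_le hx
    have h1 := h.bdryFw_pos hx
    have h2 := hb x h0
    have h3 := h.c_pos
    positivity
  by_cases hmon : ∀ᶠ x in atTop, 0 ≤ deriv b x
  · obtain ⟨X', hX'⟩ := eventually_atTop.1 hmon
    set x₀ := max X X'
    have hXx : X ≤ x₀ := le_max_left _ _
    obtain ⟨y, hy, hymax⟩ := isCompact_Icc.exists_isMaxOn
      (nonempty_Icc.2 (show x₀ ≤ x₀ + 1 by linarith))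
      (hcont.mono fun x hx => hXx.trans hx.1)
    refine ⟨bdryFw b w γ y, h.bdryFw_pos (hXx.trans hy.1), x₀, x₀ + 1, h.X_pos.trans_le hXx,
      by linarith, fun z hz => h.sum_pderiv_Fmod_nonpos hw hb hXx (by linarith) ?_ hz⟩
    intro z hz hzI
    have hXz : X ≤ z 0 := hXx.trans hzI.1.le
    have hφ := h.fst_nonneg z hz hXz (hX' _ ((le_max_right X X').trans hzI.1.le))
    have hk : bdryFw b w γ (z 0) ≤ bdryFw b w γ y := hymax ⟨hzI.1.le, hzI.2.le⟩
    exact (mul_nonpos_of_nonpos_of_nonneg (sub_nonpos.2 hk)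
      (mul_nonneg (hrate _ _ _ hzI) hφ)).trans (hright _ hXz)
  · obtain ⟨x₀, hXx, hx₀⟩ := frequently_atTop.1 (not_eventually.1 hmon) X
    have hx₀pos := h.X_pos.trans_le hXx
    obtain ⟨δ, hδ, hδb⟩ := Metric.eventually_nhds_iff.1
      ((hD2.continuousAt_deriv hx₀pos).eventually_lt_const (not_le.1 hx₀))
    set L := max 1 (2 * C * (x₀ + δ) / (c * δ ^ 2))
    have hL : 0 < L := one_pos.trans_le (le_max_left _ _)
    obtain ⟨y, hy, hymin⟩ := isCompact_Icc.exists_isMinOn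
      (nonempty_Icc.2 (show x₀ ≤ x₀ + L by linarith))
      (hcont.mono fun x hx => hXx.trans hx.1)
    have hk0 := h.bdryFw_pos (hXx.trans hy.1)
    refine ⟨bdryFw b w γ y, hk0, x₀, x₀ + L, hx₀pos,
      by linarith, fun z hz => h.sum_pderiv_Fmod_nonpos hw hb hXx (by linarith) ?_ hz⟩
    intro z hz hzI
    have hXz : X ≤ z 0 := hXx.trans hzI.1.le
    have hz0 := h.X_pos.trans_le hXz
    have hbz := hb _ hz0
    have hr := hrate _ _ _ hzI
    have hk : bdryFw b w γ y ≤ bdryFw b w γ (z 0) := hymin ⟨hzI.1.le, hzI.2.le⟩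
    rcases le_or_gt (φ z 0) 0 with hφ | hφ
    · exact (mul_nonpos_of_nonneg_of_nonpos (sub_nonneg.2 hk)
        (mul_nonpos_of_nonneg_of_nonpos hr hφ)).trans (hright _ hXz)
    · have hδz : x₀ + δ ≤ z 0 := by
        by_contra! hlt
        have hd := hδb (y := z 0) (by
          rw [Real.dist_eq, abs_of_pos (sub_pos.2 hzI.1)]
          linarith)
        exact (h.fst_nonpos z hz hXz hd.le).not_gt hφ
      have hcut := logDeriv_cutoff_mul_le hx₀pos hδ hL h.c_pos h.C_pos (le_max_right _ _) hδz hzI.2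
      rw [add_sub_cancel_left] at hr ⊢
      refine mul_le_mul (by linarith) ?_ (mul_nonneg hr hφ.le) (hk0.le.trans hk)
      calc _ ≤ 2 * (x₀ + L - z 0) / (L ^ 2 - (x₀ + L - z 0) ^ 2) ^ 2 *
            (C * (b (z 0) / z 0)) := mul_le_mul_of_nonneg_left (h.fst_le z hz hXz) hr
        _ = 2 * (x₀ + L - z 0) / (L ^ 2 - (x₀ + L - z 0) ^ 2) ^ 2 * C *
            (b (z 0) / z 0) := by ring
        _ ≤ c / z 0 * (b (z 0) / z 0) := by gcongr
        _ = c * (b (z 0) / z 0 ^ 2) := by field_simp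


end
end

section
/- Two-sided polynomial bounds for the Lyapunov function f_{w,γ} (inequality (2.7) of the paper). Assume (D2) and fix w ∈ ℝ∖{0}. Then 1 ≤ k_w < ∞, and for every γ ∈ ℝ and every (x,y) ∈ D: (x + k_w)^γ · 2^{−|γ|/|w|} ≤ f_{w,γ}(x,y) ≤ (x + k_w)^γ · 2^{|γ|/|w|}. In particular, 1/2 ≤ 1 + w(1−w)‖y‖²/(2(x + k_w)²) ≤ 3/2 for all (x,y) ∈ D. -/
open Real Filter Set Topology

noncomputable section

/-- A function continuous on `[0, ∞)`, differentiable on `(0, ∞)`, with derivative tending to `0`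
at infinity, grows sublinearly: `s * b x - x` is bounded above on `[0, ∞)`. -/
theorem bddAbove_image_mul_sub_of_tendsto_deriv {b : ℝ → ℝ} (hc : ContinuousOn b (Ici 0))
    (hdiff : DifferentiableOn ℝ b (Ioi 0)) (hlim : Tendsto (deriv b) atTop (𝓝 0))
    {s : ℝ} (hs : 0 ≤ s) : BddAbove ((fun x => s * b x - x) '' Ici (0 : ℝ)) := by
  have hs1 : 0 < 1 / (s + 1) := by positivity
  obtain ⟨X, hX⟩ := eventually_atTop.1
    ((hlim.eventually_le_const hs1).and (eventually_ge_atTop (0 : ℝ)))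
  have hX0 : 0 ≤ X := (hX X le_rfl).2
  have hcont : ContinuousOn (fun x => s * b x - x) (Icc 0 X) :=
    (continuousOn_const.mul (hc.mono Icc_subset_Ici_self)).sub continuousOn_id
  obtain ⟨M, hM⟩ := isCompact_Icc.bddAbove_image hcont
  refine ⟨M, ?_⟩
  rintro _ ⟨x, hx, rfl⟩
  rcases le_total x X with hxX | hxX
  · exact hM ⟨x, ⟨hx, hxX⟩, rfl⟩
  · have hMX : s * b X - X ≤ M := hM ⟨X, ⟨hX0, le_rfl⟩, rfl⟩
    have hmv := (convex_Ici X).image_sub_le_mul_sub_of_deriv_le (f := b) (C := 1 / (s + 1))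
      (hc.mono (Ici_subset_Ici.2 hX0))
      (by rw [interior_Ici]; exact hdiff.mono (Ioi_subset_Ioi hX0))
      (by
        intro y hy
        rw [interior_Ici] at hy
        exact (hX y (le_of_lt hy)).1)
      X self_mem_Ici x hxX hxX
    have hfrac : s * (1 / (s + 1)) ≤ 1 := by
      rw [mul_one_div, div_le_one (by positivity)]
      linarith
    have h1 := mul_le_mul_of_nonneg_left hmv hs
    have h2 := mul_le_mul_of_nonneg_right hfrac (sub_nonneg.2 hxX)
    change s * b x - x ≤ M
    linarith

/-- Real powers of a number in `[1/2, 2]` are controlled by powers of `2`. -/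
theorem two_rpow_neg_abs_le_rpow_and_le {a : ℝ} (h1 : 1 / 2 ≤ a) (h2 : a ≤ 2) (q : ℝ) :
    (2 : ℝ) ^ (-|q|) ≤ a ^ q ∧ a ^ q ≤ (2 : ℝ) ^ |q| := by
  have ha : 0 < a := by linarith
  have hlog : |Real.log a| ≤ Real.log 2 := by
    refine abs_le.2 ⟨?_, Real.log_le_log ha h2⟩
    have h := Real.log_le_log (by norm_num) h1
    rwa [one_div, Real.log_inv] at h
  have hmul : |Real.log a * q| ≤ Real.log 2 * |q| := by
    rw [abs_mul]
    exact mul_le_mul_of_nonneg_right hlog (abs_nonneg q)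
  obtain ⟨hl, hr⟩ := abs_le.1 hmul
  rw [Real.rpow_def_of_pos ha, Real.rpow_def_of_pos two_pos, Real.rpow_def_of_pos two_pos,
    Real.exp_le_exp, Real.exp_le_exp]
  exact ⟨by linarith, hr⟩

/-- **Two-sided polynomial bounds for the Lyapunov function `f_{w,γ}`**
(inequality (2.7)): under (D2), `1 ≤ k_w < ∞` and, for every `γ ∈ ℝ` and `(x,y) ∈ D`,
`(x+k_w)^γ 2^{−|γ|/|w|} ≤ f_{w,γ}(x,y) ≤ (x+k_w)^γ 2^{|γ|/|w|}`; in particular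
`1/2 ≤ 1 + w(1−w)‖y‖²/(2(x+k_w)²) ≤ 3/2` on `D`. -/
theorem fw_two_sided_bounds (d : ℕ) (hd : 0 < d) (b : ℝ → ℝ) (β : ℝ)
    (hD2 : AssumpD2 b β) (w : ℝ) (hw : w ≠ 0) :
    (1 ≤ kw b w ∧
      BddAbove ((fun x => Real.sqrt |w * (1 - w)| * b x - x) '' Ici (0 : ℝ))) ∧
    (∀ γ : ℝ, ∀ z ∈ Dom d b,
      (z 0 + kw b w) ^ γ * (2 : ℝ) ^ (-(|γ| / |w|)) ≤ fw d b w γ z ∧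
        fw d b w γ z ≤ (z 0 + kw b w) ^ γ * (2 : ℝ) ^ (|γ| / |w|)) ∧
    (∀ z ∈ Dom d b,
      1 / 2 ≤ 1 + w * (1 - w) * ynormSq d z / (2 * (z 0 + kw b w) ^ 2) ∧
        1 + w * (1 - w) * ynormSq d z / (2 * (z 0 + kw b w) ^ 2) ≤ 3 / 2) := by
  obtain ⟨⟨hc, hb0, -, hC2, -⟩, hlim, -⟩ := hD2
  have hbdd : BddAbove ((fun x => Real.sqrt |w * (1 - w)| * b x - x) '' Ici (0 : ℝ)) :=
    bddAbove_image_mul_sub_of_tendsto_deriv hc (hC2.differentiableOn (by norm_num)) hlim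
      (Real.sqrt_nonneg _)
  have hle : ∀ x : ℝ, 0 ≤ x → Real.sqrt |w * (1 - w)| * b x - x + 1 ≤ kw b w := by
    intro x hx
    have := le_csSup hbdd (mem_image_of_mem _ (mem_Ici.2 hx))
    unfold kw
    linarith
  have hk : 1 ≤ kw b w := by
    have := hle 0 le_rfl
    rw [hb0] at this
    linarith
  have hfactor : ∀ z ∈ Dom d b,
      1 / 2 ≤ 1 + w * (1 - w) * ynormSq d z / (2 * (z 0 + kw b w) ^ 2) ∧
        1 + w * (1 - w) * ynormSq d z / (2 * (z 0 + kw b w) ^ 2) ≤ 3 / 2 := by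
    rintro z ⟨hz0, hzb⟩
    have hpos : 0 < z 0 + kw b w := by linarith
    have hy : 0 ≤ ynormSq d z := Finset.sum_nonneg fun i _ => sq_nonneg _
    have hsqrt : Real.sqrt |w * (1 - w)| * ynorm d z ≤ z 0 + kw b w := by
      have h1 := mul_le_mul_of_nonneg_left hzb (Real.sqrt_nonneg |w * (1 - w)|)
      linarith [hle _ hz0]
    have hsq : |w * (1 - w) * ynormSq d z| ≤ (z 0 + kw b w) ^ 2 := by
      have h := pow_le_pow_left₀
        (mul_nonneg (Real.sqrt_nonneg _) (Real.sqrt_nonneg _)) hsqrt 2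
      rwa [mul_pow, Real.sq_sqrt (abs_nonneg _), Real.sq_sqrt hy, ← abs_of_nonneg hy,
        ← abs_mul] at h
    have hquot : |w * (1 - w) * ynormSq d z / (2 * (z 0 + kw b w) ^ 2)| ≤ 1 / 2 := by
      rw [abs_div, abs_of_pos (by positivity : 0 < 2 * (z 0 + kw b w) ^ 2),
        div_le_iff₀ (by positivity)]
      linarith
    obtain ⟨hl, hr⟩ := abs_le.1 hquot
    constructor <;> linarith
  refine ⟨⟨hk, hbdd⟩, fun γ z hz => ?_, hfactor⟩
  obtain ⟨hl, hr⟩ := hfactor z hz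
  have hpos : 0 < z 0 + kw b w := by linarith [hz.1]
  unfold fw fw1
  set a := 1 + w * (1 - w) * ynormSq d z / (2 * (z 0 + kw b w) ^ 2)
  have ha : 0 < a := by linarith
  obtain ⟨h1, h2⟩ := two_rpow_neg_abs_le_rpow_and_le hl (by linarith) (γ / w)
  rw [abs_div] at h1 h2
  rw [Real.mul_rpow hpos.le (Real.rpow_nonneg ha.le _), ← Real.rpow_mul ha.le, one_div_mul_eq_div]
  exact ⟨mul_le_mul_of_nonneg_left h1 (Real.rpow_nonneg hpos.le _),
    mul_le_mul_of_nonneg_left h2 (Real.rpow_nonneg hpos.le _)⟩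

end
end
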